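/- Assume the origin is a singular point. Then F₀(t) := ∫_{Λ_t ∩ 𝒜₀} |x|² dx tends to 0 as t → ∞, where 𝒜₀ := {x : 1/2 < |x| < 1}. -/

import Mathlib

open MeasureTheory Metric Filter Topology Pointwise

noncomputable section

abbrev En (n : ℕ) := EuclideanSpace ℝ (Fin n)

/-- symmetric trace-free matrices -/
def S0 {n : ℕ} (B : Matrix (Fin n) (Fin n) ℝ) : Prop := B.IsSymm ∧ B.trace = 0

/-- ψ_B(x) = (1/2) x·Bx -/
def psiM {n : ℕ} (B : Matrix (Fin n) (Fin n) ℝ) (x : En n) : ℝ :=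
  (1/2) * ∑ i, ∑ j, B i j * x i * x j

/-- p₀(x) = |x|²/(2n) -/
def p0 (n : ℕ) (x : En n) : ℝ := ‖x‖^2 / (2*n)

/-- q_B = p₀ + ψ_B -/
def qB {n : ℕ} (B : Matrix (Fin n) (Fin n) ℝ) (x : En n) : ℝ := p0 n x + psiM B x

/-- surface measure on the unit sphere -/
def sphMeas (n : ℕ) : Measure (En n) :=
  (Measure.hausdorffMeasure ((n:ℝ) - 1)).restrict (sphere (0:En n) 1)

/-- total surface area of the unit sphere -/
def sphArea (n : ℕ) : ℝ := (sphMeas n Set.univ).toReal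

/-- u is a C^{1,1} solution of Δu = χ_{|∇u|>0} in B₁ with 0 a free boundary point. -/
def SolutionHyp {n : ℕ} (u : En n → ℝ) : Prop :=
  (∀ x ∈ ball (0:En n) 1, DifferentiableAt ℝ u x) ∧
  (∃ L : NNReal, LipschitzOnWith L (fun x => gradient u x) (ball (0:En n) 1)) ∧
  (∀ᵐ x ∂(volume.restrict (ball (0:En n) 1)),
      ∃ D : En n →L[ℝ] En n, HasFDerivAt (fun y => gradient u y) D x ∧
        ((gradient u x = 0 → LinearMap.trace ℝ (En n) (D : En n →ₗ[ℝ] En n) = 0) ∧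
         (gradient u x ≠ 0 → LinearMap.trace ℝ (En n) (D : En n →ₗ[ℝ] En n) = 1))) ∧
  ((0:En n) ∈ frontier {x | x ∈ ball (0:En n) 1 ∧ gradient u x ≠ 0}) ∧
  gradient u 0 = 0

/-- the quadratic rescaling u_t(x) = e^{2t}(u(e^{-t}x)-u(0)) -/
def ut {n : ℕ} (u : En n → ℝ) (t : ℝ) (x : En n) : ℝ :=
  Real.exp (2*t) * (u (Real.exp (-t) • x) - u 0)

/-- Λ = {x ∈ B₁ : ∇u(x)=0} -/
def Lam {n : ℕ} (u : En n → ℝ) : Set (En n) :=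
  {x | x ∈ ball (0:En n) 1 ∧ gradient u x = 0}

/-- Λ_t = e^t Λ -/
def LamT {n : ℕ} (u : En n → ℝ) (t : ℝ) : Set (En n) := Real.exp t • Lam u

/-- B(t) is the L²(∂B₁)-projection coefficient of u_t - p₀ -/
def BProp {n : ℕ} (u : En n → ℝ) (B : ℝ → Matrix (Fin n) (Fin n) ℝ) : Prop :=
  ∀ t, 0 < t → S0 (B t) ∧
    ∀ C, S0 C →
      ∫ x, (ut u t x - p0 n x - psiM (B t) x) * psiM C x ∂(sphMeas n) = 0

/-- remainder R_t = u_t - q_{B(t)} -/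
def Rt {n : ℕ} (u : En n → ℝ) (B : ℝ → Matrix (Fin n) (Fin n) ℝ) (t : ℝ) (x : En n) : ℝ :=
  ut u t x - qB (B t) x

/-- F(t) = ∫_{Λ_t ∩ B₁} |x|² dx -/
def Fdef {n : ℕ} (u : En n → ℝ) (t : ℝ) : ℝ :=
  ∫ x in LamT u t ∩ ball (0:En n) 1, ‖x‖^2

/-- I(t) = ∫_{Λ_t ∩ B₁} x·∇R_t dx -/
def Idef {n : ℕ} (u : En n → ℝ) (B : ℝ → Matrix (Fin n) (Fin n) ℝ) (t : ℝ) : ℝ :=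
  ∫ x in LamT u t ∩ ball (0:En n) 1, ∑ i, x i * gradient (Rt u B t) x i

/-- the origin is a singular point -/
def IsSingular {n : ℕ} (u : En n → ℝ) : Prop :=
  ∃ (r : ℕ → ℝ) (Bstar : Matrix (Fin n) (Fin n) ℝ),
    (∀ k, 0 < r k) ∧ Tendsto r atTop (nhds 0) ∧ S0 Bstar ∧
    (∀ K : Set (En n), IsCompact K →
      TendstoUniformlyOn (fun k x => (u (r k • x) - u 0) / (r k)^2) (qB Bstar) atTop K ∧
      TendstoUniformlyOn (fun k x => gradient (fun y => (u (r k • y) - u 0) / (r k)^2) x)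
        (fun x => gradient (qB Bstar) x) atTop K)

/-- Frobenius norm -/
def frob {n : ℕ} (M : Matrix (Fin n) (Fin n) ℝ) : ℝ := Real.sqrt (∑ i, ∑ j, (M i j)^2)

/-- the annulus 1/2 < |x| < 1 -/
def ann0 (n : ℕ) : Set (En n) := {x | 1/2 < ‖x‖ ∧ ‖x‖ < 1}

/-- the dyadic annulus 2^{-k-1} < |x| < 2^{-k} -/
def annK (n : ℕ) (k : ℕ) : Set (En n) :=
  {x | (2:ℝ)^(-(k:ℤ)-1) < ‖x‖ ∧ ‖x‖ < (2:ℝ)^(-(k:ℤ))}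

def F0 {n : ℕ} (u : En n → ℝ) (t : ℝ) : ℝ := ∫ x in LamT u t ∩ ann0 n, ‖x‖^2

def Fk {n : ℕ} (u : En n → ℝ) (k : ℕ) (t : ℝ) : ℝ := ∫ x in LamT u t ∩ annK n k, ‖x‖^2

def I0 {n : ℕ} (u : En n → ℝ) (B : ℝ → Matrix (Fin n) (Fin n) ℝ) (t : ℝ) : ℝ :=
  ∫ x in LamT u t ∩ ann0 n, ∑ i, x i * gradient (Rt u B t) x i

def Ik {n : ℕ} (u : En n → ℝ) (B : ℝ → Matrix (Fin n) (Fin n) ℝ) (k : ℕ) (t : ℝ) : ℝ :=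
  ∫ x in LamT u t ∩ annK n k, ∑ i, x i * gradient (Rt u B t) x i

/-- ε(t) = sup_{1/2 ≤ |x| ≤ 1} |∇R_t(x)| -/
def epsd {n : ℕ} (u : En n → ℝ) (B : ℝ → Matrix (Fin n) (Fin n) ℝ) (t : ℝ) : ℝ :=
  ⨆ x ∈ {x : En n | 1/2 ≤ ‖x‖ ∧ ‖x‖ ≤ 1}, ‖gradient (Rt u B t) x‖

/-- trace-free part of a matrix -/
def tf {n : ℕ} (M : Matrix (Fin n) (Fin n) ℝ) : Matrix (Fin n) (Fin n) ℝ :=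
  Matrix.of fun i j => M i j - (M.trace / n) * (if i = j then 1 else 0)

/-- second moment matrix of Λ_t ∩ B₁ -/
def momMat {n : ℕ} (u : En n → ℝ) (t : ℝ) : Matrix (Fin n) (Fin n) ℝ :=
  Matrix.of fun i j => ∫ x in LamT u t ∩ ball (0:En n) 1, x i * x j

/-- V(t) -/
def Vdef {n : ℕ} (u : En n → ℝ) (t : ℝ) : ℝ :=
  ∑' k : ℕ, (2:ℝ)^(-((k * (n+2) : ℕ) : ℤ)) * F0 u (t + k * Real.log 2) *
    ∫ τ in t..(t + k * Real.log 2), Fdef u τ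


/-- The functions whose integral exists and vanishes. -/
def ZeroIntegral {α : Type*} [MeasurableSpace α] (μ : Measure α) (f : α → ℝ) : Prop :=
  Integrable f μ ∧ ∫ x, f x ∂μ = 0

namespace ZeroIntegral

variable {α : Type*} [MeasurableSpace α] {μ : Measure α} {f g : α → ℝ}

lemma sub (hf : ZeroIntegral μ f) (hg : ZeroIntegral μ g) :
    ZeroIntegral μ (fun x => f x - g x) :=
  ⟨hf.1.sub hg.1, by rw [integral_sub hf.1 hg.1, hf.2, hg.2, sub_zero]⟩

lemma sum {ι : Type*} {s : Finset ι} {F : ι → α → ℝ} (h : ∀ i ∈ s, ZeroIntegral μ (F i)) :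
    ZeroIntegral μ (fun x => ∑ i ∈ s, F i x) :=
  ⟨integrable_finsetSum s fun i hi => (h i hi).1, by
    rw [integral_finsetSum s fun i hi => (h i hi).1]
    exact Finset.sum_eq_zero fun i hi => (h i hi).2⟩

lemma congr (hf : ZeroIntegral μ f) (h : f =ᵐ[μ] g) : ZeroIntegral μ g :=
  ⟨hf.1.congr h, by rw [← integral_congr_ae h, hf.2]⟩

end ZeroIntegral

section LipschitzIntegration

variable {E : Type*} [NormedAddCommGroup E] [NormedSpace ℝ E] [FiniteDimensional ℝ E]
  [MeasurableSpace E] [BorelSpace E] {μ : Measure E} [μ.IsAddHaarMeasure]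
  {a w : E → ℝ} {Ca Cw : NNReal}

lemma LipschitzWith.integrable_lineDeriv (ha : LipschitzWith Ca a) (hsa : HasCompactSupport a)
    (p : E) : Integrable (fun x => lineDeriv ℝ a x p) μ := by
  have hzero : ∀ x, x ∉ tsupport a → lineDeriv ℝ a x p = 0 := by
    intro x hx
    have hev : a =ᶠ[𝓝 x] fun _ => (0 : ℝ) := notMem_tsupport_iff_eventuallyEq.1 hx
    rw [hev.lineDeriv_eq]
    simp [lineDeriv]
  have hK : IsCompact (tsupport a) := hsa
  have hint : IntegrableOn (fun x => lineDeriv ℝ a x p) (tsupport a) μ :=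
    (ha.locallyIntegrable_lineDeriv p).integrableOn_isCompact hK
  exact (integrableOn_iff_integrable_of_support_subset fun x hx => by
    by_contra h; exact hx (hzero x h)).1 hint

lemma LipschitzWith.integral_lineDeriv_eq_zero (ha : LipschitzWith Ca a)
    (hsa : HasCompactSupport a) (p : E) : ∫ x, lineDeriv ℝ a x p ∂μ = 0 := by
  have h := (LipschitzWith.const (1 : ℝ) : LipschitzWith 0 fun _ : E => (1 : ℝ)
    ).integral_lineDeriv_mul_eq (μ := μ) ha hsa (-p)
  simpa [lineDeriv] using h.symm

/-- Two directional derivatives may be exchanged in the integral of a product of first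
derivatives of Lipschitz functions. -/
lemma LipschitzWith.integral_lineDeriv_mul_lineDeriv_comm (ha : LipschitzWith Ca a)
    (hsa : HasCompactSupport a) (hw : LipschitzWith Cw w) (hsw : HasCompactSupport w) (p q : E) :
    ∫ x, lineDeriv ℝ a x p * lineDeriv ℝ w x q ∂μ =
      ∫ x, lineDeriv ℝ a x q * lineDeriv ℝ w x p ∂μ := by
  have hA := hw.integral_inv_smul_sub_mul_tendsto_integral_lineDeriv_mul (μ := μ)
    (ha.integrable_lineDeriv hsa p) q
  have hB := (ha.integral_inv_smul_sub_mul_tendsto_integral_lineDeriv_mul (μ := μ)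
    (hw.integrable_lineDeriv hsw p) (-q)).neg
  have hdiff := hw.ae_lineDifferentiableAt (μ := μ) p
  have key : ∀ t : ℝ, ∫ x, (t⁻¹ • (w (x + t • q) - w x)) * lineDeriv ℝ a x p ∂μ =
      - ∫ x, (t⁻¹ • (a (x + t • (-q)) - a x)) * lineDeriv ℝ w x p ∂μ := by
    intro t
    have hshift : LipschitzWith Cw fun x => w (x + t • q) := by
      simpa [Function.comp_def] using hw.comp (LipschitzWith.id.add (LipschitzWith.const (t • q)))
    have h1 := hshift.integral_lineDeriv_mul_eq (μ := μ) ha hsa p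
    have h2 := hw.integral_lineDeriv_mul_eq (μ := μ) ha hsa p
    have hshiftderiv : ∀ x, lineDeriv ℝ (fun x => w (x + t • q)) x p
        = lineDeriv ℝ w (x + t • q) p := by
      intro x
      simp only [lineDeriv]
      congr 1
      ext r
      congr 1
      abel
    have h3 : ∫ x, lineDeriv ℝ w (x + t • q) p * a x ∂μ =
        ∫ x, lineDeriv ℝ w x p * a (x + t • (-q)) ∂μ := by
      rw [← integral_add_right_eq_self _ (t • (-q))]
      simp
    have hia : Integrable (fun x => lineDeriv ℝ a x p) μ := ha.integrable_lineDeriv hsa p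
    have hiw : Integrable (fun x => lineDeriv ℝ w x p) μ := hw.integrable_lineDeriv hsw p
    obtain ⟨Mw, hMw⟩ := hw.continuous.bounded_above_of_compact_support hsw
    obtain ⟨Ma, hMa⟩ := ha.continuous.bounded_above_of_compact_support hsa
    have i1 : Integrable (fun x => w (x + t • q) * lineDeriv ℝ a x p) μ :=
      hia.bdd_mul (c := Mw) hshift.continuous.aestronglyMeasurable
        (Eventually.of_forall fun x => hMw _)
    have i2 : Integrable (fun x => w x * lineDeriv ℝ a x p) μ :=
      hia.bdd_mul (c := Mw) hw.continuous.aestronglyMeasurable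
        (Eventually.of_forall fun x => hMw _)
    have i3 : Integrable (fun x => a (x + t • (-q)) * lineDeriv ℝ w x p) μ :=
      hiw.bdd_mul (c := Ma) (ha.continuous.comp (continuous_add_const _)).aestronglyMeasurable
        (Eventually.of_forall fun x => hMa _)
    have i4 : Integrable (fun x => a x * lineDeriv ℝ w x p) μ :=
      hiw.bdd_mul (c := Ma) ha.continuous.aestronglyMeasurable
        (Eventually.of_forall fun x => hMa _)
    simp_rw [smul_eq_mul, mul_assoc, integral_const_mul, _root_.sub_mul]
    rw [integral_sub i1 i2, integral_sub i3 i4]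
    simp_rw [hshiftderiv, lineDeriv_neg, neg_mul, integral_neg] at h1 h2
    rw [h3] at h1
    simp_rw [mul_comm (lineDeriv ℝ _ _ _)] at h1 h2
    linarith [congrArg (fun r => t⁻¹ * r) h1, congrArg (fun r => t⁻¹ * r) h2]
  simp_rw [key] at hA
  have h := tendsto_nhds_unique hA hB
  simp_rw [lineDeriv_neg, neg_mul, integral_neg, neg_neg] at h
  simp_rw [mul_comm (lineDeriv ℝ a _ p), h]

end LipschitzIntegration
section LipschitzOnUnitBall

variable {E : Type*} [NormedAddCommGroup E]

/-- Real functions that are Lipschitz on the open unit ball. -/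
def LipUnit (F : E → ℝ) : Prop := ∃ C : NNReal, LipschitzOnWith C F (ball (0 : E) 1)

namespace LipUnit

variable {F G η : E → ℝ} {ρ : ℝ}

lemma bounded (hF : LipUnit F) : ∃ M : ℝ, 0 ≤ M ∧ ∀ x ∈ ball (0 : E) 1, |F x| ≤ M := by
  obtain ⟨C, hC⟩ := hF
  refine ⟨|F 0| + C, by positivity, fun x hx => ?_⟩
  have h := hC.dist_le_mul x hx 0 (mem_ball_self one_pos)
  rw [Real.dist_eq] at h
  have h1 : (C : ℝ) * dist x 0 ≤ C * 1 := by
    gcongr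
    exact (mem_ball.1 hx).le
  have h2 := abs_add_le (F x - F 0) (F 0)
  rw [sub_add_cancel] at h2
  linarith

lemma of_dist_le {C : ℝ} (hC : 0 ≤ C)
    (h : ∀ x ∈ ball (0 : E) 1, ∀ y ∈ ball (0 : E) 1, |F x - F y| ≤ C * dist x y) : LipUnit F :=
  ⟨⟨C, hC⟩, LipschitzOnWith.of_dist_le_mul fun x hx y hy => by
    rw [Real.dist_eq]; exact h x hx y hy⟩

lemma of_lipschitzWith {C : NNReal} (h : LipschitzWith C F) : LipUnit F :=
  ⟨C, h.lipschitzOnWith⟩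

lemma const (c : ℝ) : LipUnit (fun _ : E => c) := of_lipschitzWith (LipschitzWith.const c)

lemma abs_sub_le (hF : LipUnit F) : ∃ C : ℝ, 0 ≤ C ∧
    ∀ x ∈ ball (0 : E) 1, ∀ y ∈ ball (0 : E) 1, |F x - F y| ≤ C * dist x y := by
  obtain ⟨C, hC⟩ := hF
  exact ⟨C, C.2, fun x hx y hy => by simpa [Real.dist_eq] using hC.dist_le_mul x hx y hy⟩

lemma mul (hF : LipUnit F) (hG : LipUnit G) : LipUnit (fun x => F x * G x) := by
  obtain ⟨A, hA0, hA⟩ := hF.abs_sub_le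
  obtain ⟨B, hB0, hB⟩ := hG.abs_sub_le
  obtain ⟨M, hM0, hM⟩ := hF.bounded
  obtain ⟨N, hN0, hN⟩ := hG.bounded
  refine of_dist_le (C := M * B + A * N) (by positivity) fun x hx y hy => ?_
  have h : F x * G x - F y * G y = F x * (G x - G y) + (F x - F y) * G y := by ring
  calc |F x * G x - F y * G y| ≤ |F x| * |G x - G y| + |F x - F y| * |G y| := by
        rw [h, ← abs_mul, ← abs_mul]; exact abs_add_le _ _
    _ ≤ M * (B * dist x y) + (A * dist x y) * N := by
        gcongr
        exacts [hM x hx, hB x hx y hy, hA x hx y hy, hN y hy]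
    _ = (M * B + A * N) * dist x y := by ring

lemma add (hF : LipUnit F) (hG : LipUnit G) : LipUnit (fun x => F x + G x) := by
  obtain ⟨A, hA0, hA⟩ := hF.abs_sub_le
  obtain ⟨B, hB0, hB⟩ := hG.abs_sub_le
  refine of_dist_le (C := A + B) (by positivity) fun x hx y hy => ?_
  have h : F x + G x - (F y + G y) = (F x - F y) + (G x - G y) := by ring
  rw [h, add_mul]
  exact (abs_add_le _ _).trans (add_le_add (hA x hx y hy) (hB x hx y hy))

lemma sub (hF : LipUnit F) (hG : LipUnit G) : LipUnit (fun x => F x - G x) := by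
  simpa [sub_eq_add_neg] using hF.add ((const (-1)).mul hG)

lemma sum {ι : Type*} {s : Finset ι} {F : ι → E → ℝ} (h : ∀ i ∈ s, LipUnit (F i)) :
    LipUnit (fun x => ∑ i ∈ s, F i x) := by
  classical
  induction s using Finset.induction_on with
  | empty => simpa using const (E := E) 0
  | insert i s hi ih =>
    simp_rw [Finset.sum_insert hi]
    exact (h i (Finset.mem_insert_self i s)).add
      (ih fun j hj => h j (Finset.mem_insert_of_mem hj))

lemma ae_differentiableAt [NormedSpace ℝ E] [FiniteDimensional ℝ E] [MeasurableSpace E] [BorelSpace E]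
    {μ : Measure E} [μ.IsAddHaarMeasure] (hF : LipUnit F) :
    ∀ᵐ x ∂μ, x ∈ ball (0 : E) 1 → DifferentiableAt ℝ F x := by
  obtain ⟨C, hC⟩ := hF
  filter_upwards [hC.ae_differentiableWithinAt_of_mem (μ := μ)] with x hx hxb
  exact (hx hxb).differentiableAt (isOpen_ball.mem_nhds hxb)

lemma exists_lipschitzWith_mul {K : NNReal} (hF : LipUnit F) (hη : LipschitzWith K η)
    (hz : ∀ x, ρ ≤ ‖x‖ → η x = 0) (hρ : ρ < 1) :
    ∃ C, LipschitzWith C (fun x => η x * F x) := by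
  obtain ⟨A, hA0, hA⟩ := hF.abs_sub_le
  obtain ⟨M, hM0, hM⟩ := hF.bounded
  obtain ⟨N, hN0, hN⟩ := (of_lipschitzWith hη).bounded
  have hηd : ∀ x y, |η x - η y| ≤ K * dist x y := fun x y => by
    simpa [Real.dist_eq] using hη.dist_le_mul x y
  have hout : ∀ x, x ∉ ball (0 : E) 1 → η x = 0 := fun x hx =>
    hz x (hρ.le.trans (by simpa using hx))
  refine ⟨⟨K * M + N * A, by positivity⟩, LipschitzWith.of_dist_le_mul fun x y => ?_⟩
  rw [Real.dist_eq]
  change _ ≤ (K * M + N * A) * dist x y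
  have hd := dist_nonneg (x := x) (y := y)
  by_cases hx : x ∈ ball (0 : E) 1
  · by_cases hy : y ∈ ball (0 : E) 1
    · have h : η x * F x - η y * F y = (η x - η y) * F x + η y * (F x - F y) := by ring
      calc |η x * F x - η y * F y| ≤ |η x - η y| * |F x| + |η y| * |F x - F y| := by
            rw [h, ← abs_mul, ← abs_mul]; exact abs_add_le _ _
        _ ≤ (K * dist x y) * M + N * (A * dist x y) := by
            gcongr
            exacts [hηd x y, hM x hx, hN y hy, hA x hx y hy]
        _ = _ := by ring
    · have h : η x * F x - η y * F y = (η x - η y) * F x := by rw [hout y hy]; ring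
      calc |η x * F x - η y * F y| = |η x - η y| * |F x| := by rw [h, abs_mul]
        _ ≤ (K * dist x y) * M := by
            gcongr
            exacts [hηd x y, hM x hx]
        _ ≤ _ := by nlinarith [mul_nonneg (mul_nonneg hN0 hA0) hd]
  · by_cases hy : y ∈ ball (0 : E) 1
    · have h : η x * F x - η y * F y = (η x - η y) * F y := by rw [hout x hx]; ring
      calc |η x * F x - η y * F y| = |η x - η y| * |F y| := by rw [h, abs_mul]
        _ ≤ (K * dist x y) * M := by
            gcongr
            exacts [hηd x y, hM y hy]
        _ ≤ _ := by nlinarith [mul_nonneg (mul_nonneg hN0 hA0) hd]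
    · simp only [hout x hx, hout y hy, zero_mul, sub_self, abs_zero]
      positivity

end LipUnit

variable [NormedSpace ℝ E]

/-- Continuously differentiable functions vanishing outside a ball of radius `ρ < 1`. -/
structure IsTest (η : E → ℝ) (ρ : ℝ) : Prop where
  contDiff : ContDiff ℝ 1 η
  eq_zero : ∀ x, ρ ≤ ‖x‖ → η x = 0
  lt_one : ρ < 1

namespace IsTest

variable {F W η : E → ℝ} {ρ : ℝ}

lemma hasCompactSupport_mul [FiniteDimensional ℝ E] (hη : IsTest η ρ) (F : E → ℝ) :
    HasCompactSupport (fun x => η x * F x) :=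
  HasCompactSupport.intro (isCompact_closedBall (0 : E) ρ) fun x hx => by
    rw [hη.eq_zero x (by simpa using (not_le.1 fun h => hx (by simpa using h)).le), zero_mul]

lemma exists_lipschitzWith [FiniteDimensional ℝ E] (hη : IsTest η ρ) :
    ∃ K, LipschitzWith K η := by
  have h := hη.hasCompactSupport_mul (fun _ => 1)
  simp only [mul_one] at h
  exact hη.contDiff.lipschitzWith_of_hasCompactSupport h one_ne_zero

lemma eventuallyEq_zero (hη : IsTest η ρ) {x : E} (hx : x ∉ ball (0 : E) 1) :
    η =ᶠ[𝓝 x] fun _ => 0 := by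
  have h1 : ρ < ‖x‖ := hη.lt_one.trans_le (by simpa using hx)
  filter_upwards [continuous_norm.continuousAt.eventually (lt_mem_nhds h1)] with y hy
  exact hη.eq_zero y hy.le

lemma fderiv_eq_zero (hη : IsTest η ρ) {x : E} (hx : x ∉ ball (0 : E) 1) :
    fderiv ℝ η x = 0 := by
  rw [(hη.eventuallyEq_zero hx).fderiv_eq]
  simp

variable [FiniteDimensional ℝ E] [MeasurableSpace E] [BorelSpace E]
  {μ : Measure E} [μ.IsAddHaarMeasure]

lemma ae_lineDeriv_mul (hη : IsTest η ρ) (hF : LipUnit F) (p : E) :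
    ∀ᵐ x ∂μ, lineDeriv ℝ (fun y => η y * F y) x p =
      fderiv ℝ η x p * F x + η x * fderiv ℝ F x p := by
  filter_upwards [hF.ae_differentiableAt (μ := μ)] with x hx
  by_cases hxb : x ∈ ball (0 : E) 1
  · have hd : DifferentiableAt ℝ η x := hη.contDiff.differentiable one_ne_zero x
    rw [(hd.fun_mul (hx hxb)).lineDeriv_eq_fderiv, fderiv_fun_mul hd (hx hxb)]
    simp only [_root_.add_apply, _root_.smul_apply, smul_eq_mul]
    ring
  · have hev : (fun y => η y * F y) =ᶠ[𝓝 x] fun _ => 0 := by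
      filter_upwards [hη.eventuallyEq_zero hxb] with y hy
      rw [hy, zero_mul]
    rw [hev.lineDeriv_eq, hη.fderiv_eq_zero hxb, (hη.eventuallyEq_zero hxb).eq_of_nhds]
    simp [lineDeriv]

/-- The integral of a derivative of a compactly supported Lipschitz function vanishes. -/
lemma zeroIntegral_fderiv_mul (hη : IsTest η ρ) (hF : LipUnit F) (p : E) :
    ZeroIntegral μ (fun x => fderiv ℝ η x p * F x + η x * fderiv ℝ F x p) := by
  obtain ⟨K, hK⟩ := hη.exists_lipschitzWith
  obtain ⟨C, hC⟩ := hF.exists_lipschitzWith_mul hK hη.eq_zero hη.lt_one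
  have hs := hη.hasCompactSupport_mul F
  exact ZeroIntegral.congr ⟨hC.integrable_lineDeriv hs p, hC.integral_lineDeriv_eq_zero hs p⟩
    (hη.ae_lineDeriv_mul hF p)

/-- The exchange of two derivatives, for functions that are Lipschitz on the unit ball. -/
lemma zeroIntegral_fderiv_mul_fderiv_comm (hη : IsTest η ρ) (hF : LipUnit F) (hW : LipUnit W)
    (p q : E) :
    ZeroIntegral μ (fun x =>
      (fderiv ℝ η x p * F x + η x * fderiv ℝ F x p) * fderiv ℝ W x q -
      (fderiv ℝ η x q * F x + η x * fderiv ℝ F x q) * fderiv ℝ W x p) := by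
  have hpos : 0 ≤ max ρ 0 := le_max_right _ _
  have hlt : max ρ 0 < 1 := max_lt hη.lt_one one_pos
  let ζ : ContDiffBump (0 : E) :=
    ⟨(1 + 2 * max ρ 0) / 3, (2 + max ρ 0) / 3, by linarith, by linarith⟩
  have hζ : IsTest ζ ((2 + max ρ 0) / 3) :=
    ⟨ζ.contDiff, fun x hx => ζ.zero_of_le_dist (by simpa using hx), by linarith⟩
  obtain ⟨K, hK⟩ := hη.exists_lipschitzWith
  obtain ⟨C, hC⟩ := hF.exists_lipschitzWith_mul hK hη.eq_zero hη.lt_one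
  have hs := hη.hasCompactSupport_mul F
  obtain ⟨K', hK'⟩ := hζ.exists_lipschitzWith
  obtain ⟨C', hC'⟩ := hW.exists_lipschitzWith_mul hK' hζ.eq_zero hζ.lt_one
  have hs' := hζ.hasCompactSupport_mul W
  have hint : ∀ p q : E, Integrable (fun x => lineDeriv ℝ (fun y => η y * F y) x p *
      lineDeriv ℝ (fun y => ζ y * W y) x q) μ := fun p q =>
    (hC.integrable_lineDeriv hs p).mul_bdd (c := C' * ‖q‖)
      (aestronglyMeasurable_lineDeriv hC'.continuous μ)
      (Eventually.of_forall fun x => norm_lineDeriv_le_of_lipschitz ℝ hC')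
  have hprod : ∀ p q : E, ∀ᵐ x ∂μ, lineDeriv ℝ (fun y => η y * F y) x p *
      lineDeriv ℝ (fun y => ζ y * W y) x q =
        (fderiv ℝ η x p * F x + η x * fderiv ℝ F x p) * fderiv ℝ W x q := by
    intro p q
    filter_upwards [hη.ae_lineDeriv_mul hF p, hW.ae_differentiableAt (μ := μ)] with x h1 h2
    rw [h1]
    by_cases hx : x ∈ ball (0 : E) ((1 + 2 * max ρ 0) / 3)
    · have hxb : x ∈ ball (0 : E) 1 := ball_subset_ball (by linarith) hx
      have hev : (fun y => ζ y * W y) =ᶠ[𝓝 x] W := by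
        filter_upwards [isOpen_ball.mem_nhds hx] with y hy
        rw [ζ.one_of_mem_closedBall (ball_subset_closedBall hy), one_mul]
      rw [hev.lineDeriv_eq, (h2 hxb).lineDeriv_eq_fderiv]
    · have hρx : ρ < ‖x‖ := by
        have : (1 + 2 * max ρ 0) / 3 ≤ ‖x‖ := by simpa using hx
        linarith [le_max_left ρ 0]
      have hev : η =ᶠ[𝓝 x] fun _ => 0 := by
        filter_upwards [continuous_norm.continuousAt.eventually (lt_mem_nhds hρx)] with y hy
        exact hη.eq_zero y hy.le
      rw [hev.fderiv_eq, hev.eq_of_nhds]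
      simp
  refine ZeroIntegral.congr ⟨(hint p q).sub (hint q p), ?_⟩ (EventuallyEq.sub (hprod p q) (hprod q p))
  have := integral_sub (hint p q) (hint q p)
  simp only [Pi.sub_apply] at this ⊢
  rw [this, hC.integral_lineDeriv_mul_lineDeriv_comm hs hC' hs' p q, sub_self]

end IsTest

end LipschitzOnUnitBall
section PointwiseIdentities

variable {n : ℕ} (x v z : Fin n → ℝ) (d : Fin n → Fin n → ℝ)

lemma sum_radial_first_variation {φ g γ : ℝ} (hsymm : ∀ i j, d i j = d j i)
    (htr : ∀ j, (∑ i, d i i) * v j = v j) :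
    (∑ i, ∑ j, ((γ * x i * x j + g * if i = j then 1 else 0) * (v i * v j) +
        g * x j * (d i i * v j + v i * d j i))) -
      (∑ i, ∑ j, ((γ * x j * x j + g) * (v i * v i) + g * x j * (d i j * v i + v i * d i j))) -
      (∑ i, (-g * x i * v i + φ * d i i)) =
    g * (2 * ∑ i, x i * v i - n * ∑ i, v i * v i) -
      γ * ((∑ i, x i * x i) * (∑ i, v i * v i) - (∑ i, x i * v i) ^ 2) - φ * (∑ i, d i i) -
      g * ∑ i, v i * ((∑ k, d i k * x k) - v i) := by
  have h1 : ∑ i, ∑ j, ((γ * x i * x j + g * if i = j then 1 else 0) * (v i * v j) +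
        g * x j * (d i i * v j + v i * d j i)) =
      γ * (∑ i, x i * v i) ^ 2 + g * (∑ i, v i * v i) + g * (∑ i, x i * v i) +
        g * ∑ i, v i * (∑ k, d i k * x k) := by
    have e1 : (∑ i, x i * v i) = ∑ i, ∑ j, d i i * (x j * v j) := by
      rw [← Finset.sum_mul_sum, Finset.mul_sum]
      exact Finset.sum_congr rfl fun j _ => by rw [mul_left_comm, htr]
    conv_rhs => rw [sq, Finset.sum_mul_sum]
    conv_rhs => enter [1, 2]; rw [e1]
    simp_rw [Finset.mul_sum]
    have e2 : ∑ i, g * (v i * v i) = ∑ i, ∑ j, (g * if i = j then 1 else 0) * (v i * v j) := by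
      simp
    rw [e2]
    simp_rw [← Finset.sum_add_distrib]
    refine Finset.sum_congr rfl fun i _ => Finset.sum_congr rfl fun j _ => ?_
    rw [hsymm j i]
    ring
  have h2 : ∑ i, ∑ j, ((γ * x j * x j + g) * (v i * v i) +
        g * x j * (d i j * v i + v i * d i j)) =
      γ * ((∑ i, x i * x i) * (∑ i, v i * v i)) + n * g * (∑ i, v i * v i) +
        2 * g * ∑ i, v i * (∑ k, d i k * x k) := by
    have e2 : n * g * ∑ i, v i * v i = ∑ i, ∑ j : Fin n, g * (v i * v i) := by
      simp only [Finset.sum_const, Finset.card_univ, Fintype.card_fin, nsmul_eq_mul,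
        Finset.mul_sum]
      exact Finset.sum_congr rfl fun i _ => by ring
    rw [e2, mul_comm (∑ i, x i * x i), Finset.sum_mul_sum]
    simp_rw [Finset.mul_sum, ← Finset.sum_add_distrib]
    exact Finset.sum_congr rfl fun i _ => Finset.sum_congr rfl fun j _ => by ring
  have h3 : ∑ i, (-g * x i * v i + φ * d i i) = -g * (∑ i, x i * v i) + φ * ∑ i, d i i := by
    simp_rw [Finset.mul_sum, ← Finset.sum_add_distrib]
    exact Finset.sum_congr rfl fun i _ => by ring
  have h4 : ∑ i, v i * ((∑ k, d i k * x k) - v i) =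
      (∑ i, v i * (∑ k, d i k * x k)) - ∑ i, v i * v i := by
    rw [← Finset.sum_sub_distrib]
    exact Finset.sum_congr rfl fun i _ => by ring
  rw [h1, h2, h3, h4]
  ring

lemma sum_radial_second_variation {g γ ω : ℝ} (hsymm : ∀ i j, d i j = d j i)
    (hz : ∀ i, z i = (∑ k, d i k * x k) - v i) (htr : ∀ j, (∑ i, d i i) * z j = z j) :
    (∑ i, ∑ k, ((γ * x k * x i + g * if k = i then 1 else 0) * (z i * v k + ω * d k i) -
        (γ * x i * x i + g) * (z k * v k + ω * d k k))) -
      (∑ i, ∑ k, (((γ * x i * x k + g * if i = k then 1 else 0) * ω + g * x k * z i) * d i k -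
        ((γ * x k * x k + g) * ω + g * x k * z k) * d i i)) =
    g * (∑ i, x i * z i - n * (∑ i, z i * v i) - ∑ i, z i * z i) -
      γ * ((∑ i, x i * x i) * (∑ i, z i * v i) - (∑ i, x i * z i) * (∑ i, x i * v i)) := by
  have hc : ∀ i, (∑ k, d i k * x k) = z i + v i := fun i => by rw [hz]; ring
  have h1 : ∑ i, ∑ k, ((γ * x k * x i + g * if k = i then 1 else 0) * (z i * v k + ω * d k i) -
        (γ * x i * x i + g) * (z k * v k + ω * d k k)) =
      γ * ((∑ i, x i * z i) * (∑ i, x i * v i)) + g * (∑ i, z i * v i)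
        + (∑ i, ∑ k, ω * γ * x i * x k * d i k) + g * ω * (∑ i, d i i)
        - γ * ((∑ i, x i * x i) * (∑ i, z i * v i)) - n * g * (∑ i, z i * v i)
        - γ * ω * ((∑ i, x i * x i) * (∑ i, d i i)) - n * g * ω * (∑ i, d i i) := by
    have e1 : g * (∑ i, z i * v i) + g * ω * (∑ i, d i i) = ∑ i, ∑ k,
        (g * if k = i then 1 else 0) * (z i * v k + ω * d k i) := by
      simp only [mul_ite, mul_one, mul_zero, ite_mul, zero_mul, Finset.sum_ite_eq',
        Finset.mem_univ, if_true, Finset.mul_sum, ← Finset.sum_add_distrib]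
      exact Finset.sum_congr rfl fun i _ => by ring
    have e2 : n * g * (∑ i, z i * v i) = ∑ i : Fin n, ∑ k, g * (z k * v k) := by
      simp only [Finset.sum_const, Finset.card_univ, Fintype.card_fin, nsmul_eq_mul,
        Finset.mul_sum]
      exact Finset.sum_congr rfl fun i _ => by ring
    have e3 : n * g * ω * (∑ i, d i i) = ∑ i : Fin n, ∑ k, g * ω * d k k := by
      simp only [Finset.sum_const, Finset.card_univ, Fintype.card_fin, nsmul_eq_mul,
        Finset.mul_sum]
      exact Finset.sum_congr rfl fun i _ => by ring
    have e4 : ∀ A B C D F G H I : ℝ, A + B + C + D - F - G - H - I =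
        A + C + (B + D) - F - G - H - I := by intros; ring
    rw [e4, e1, e2, e3, Finset.sum_mul_sum, Finset.sum_mul_sum, Finset.sum_mul_sum]
    simp_rw [Finset.mul_sum, ← Finset.sum_add_distrib, ← Finset.sum_sub_distrib]
    refine Finset.sum_congr rfl fun i _ => Finset.sum_congr rfl fun k _ => ?_
    rw [hsymm k i]
    ring
  have h2 : ∑ i, ∑ k, (((γ * x i * x k + g * if i = k then 1 else 0) * ω + g * x k * z i) * d i k -
        ((γ * x k * x k + g) * ω + g * x k * z k) * d i i) =
      (∑ i, ∑ k, ω * γ * x i * x k * d i k) + g * ω * (∑ i, d i i)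
        + g * (∑ i, z i * (∑ k, d i k * x k)) - γ * ω * ((∑ i, x i * x i) * (∑ i, d i i))
        - n * g * ω * (∑ i, d i i) - g * ∑ i, x i * z i := by
    have e1 : g * ω * (∑ i, d i i) = ∑ i, ∑ k,
        (g * if i = k then 1 else 0) * ω * d i k := by
      simp [Finset.mul_sum]
    have e3 : n * g * ω * (∑ i, d i i) = ∑ i : Fin n, ∑ k : Fin n, g * ω * d i i := by
      simp only [Finset.sum_const, Finset.card_univ, Fintype.card_fin, nsmul_eq_mul,
        Finset.mul_sum]
      exact Finset.sum_congr rfl fun i _ => by ring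
    have e5 : (∑ i, x i * z i) = ∑ i, ∑ j, d i i * (x j * z j) := by
      rw [← Finset.sum_mul_sum, Finset.mul_sum]
      exact Finset.sum_congr rfl fun j _ => by rw [mul_left_comm, htr]
    rw [e1, e3, e5, mul_comm (∑ i, x i * x i), Finset.sum_mul_sum]
    simp_rw [Finset.mul_sum, ← Finset.sum_add_distrib, ← Finset.sum_sub_distrib]
    exact Finset.sum_congr rfl fun i _ => Finset.sum_congr rfl fun k _ => by ring
  have h3 : ∑ i, z i * (∑ k, d i k * x k) = (∑ i, z i * z i) + ∑ i, z i * v i := by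
    simp_rw [hc, ← Finset.sum_add_distrib]
    exact Finset.sum_congr rfl fun i _ => by ring
  rw [h1, h2, h3]
  ring

end PointwiseIdentities

section RadialKernels

variable {n : ℕ}

/-- A radial test function `φ` with `∇φ = -g x` and `∇g = γ x`. -/
structure RadialKernel (φ g γ : En n → ℝ) (ρ : ℝ) : Prop where
  isTest : IsTest φ ρ
  isTest_weight : IsTest g ρ
  fderiv_apply : ∀ x p, fderiv ℝ φ x p = -g x * inner ℝ x p
  fderiv_weight_apply : ∀ x p, fderiv ℝ g x p = γ x * inner ℝ x p
  continuous_second : Continuous γ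
  second_eq_zero : ∀ x, ρ ≤ ‖x‖ → γ x = 0

/-- The matrix of the derivative of a vector field. -/
def jac (V : En n → En n) (x : En n) (i j : Fin n) : ℝ :=
  fderiv ℝ V x (EuclideanSpace.single j 1) i

/-- The divergence of a vector field. -/
def divg (V : En n → En n) (x : En n) : ℝ := ∑ i, jac V x i i

/-- The failure of a vector field to be one-homogeneous. -/
def defect (V : En n → En n) (x : En n) : En n := fderiv ℝ V x x - V x

/-- A Lipschitz gradient field `V = ∇U` on the unit ball whose divergence is `1` almost everywhere
where it does not vanish, and whose derivative vanishes almost everywhere else. -/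
structure PotentialField (U : En n → ℝ) (V : En n → En n) : Prop where
  lipschitz : ∃ C, LipschitzWith C V
  hasFDerivAt : ∀ x ∈ ball (0 : En n) 1, HasFDerivAt U (innerSL ℝ (V x)) x
  ae_divg : ∀ᵐ x, x ∈ ball (0 : En n) 1 →
    divg V x = 1 ∨ (V x = 0 ∧ fderiv ℝ V x = 0)

lemma inner_eq_sum (x y : En n) : inner ℝ x y = ∑ i, x i * y i := by
  rw [PiLp.inner_apply]
  exact Finset.sum_congr rfl fun i _ => by simp [mul_comm]

lemma fderiv_component {V : En n → En n} {x : En n} (hV : DifferentiableAt ℝ V x) (p : En n)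
    (i : Fin n) : fderiv ℝ (fun y => V y i) x p = fderiv ℝ V x p i := by
  have h := ((EuclideanSpace.proj (𝕜 := ℝ) i).hasFDerivAt.comp x hV.hasFDerivAt).fderiv
  have e : (fun y => V y i) = (EuclideanSpace.proj (𝕜 := ℝ) i) ∘ V := rfl
  rw [e, h]
  rfl

lemma differentiableAt_component {V : En n → En n} {x : En n} (hV : DifferentiableAt ℝ V x)
    (i : Fin n) : DifferentiableAt ℝ (fun y => V y i) x :=
  ((EuclideanSpace.proj (𝕜 := ℝ) i).hasFDerivAt.comp x hV.hasFDerivAt).differentiableAt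

lemma fderiv_apply_eq_sum_jac (V : En n → En n) (x p : En n) (i : Fin n) :
    fderiv ℝ V x p i = ∑ k, jac V x i k * p k := by
  have hp : p = ∑ k, p k • EuclideanSpace.single k (1 : ℝ) := by
    ext j
    simp [Pi.single_apply]
  conv_lhs => rw [hp, map_sum]
  simp [jac, mul_comm]

lemma defect_apply (V : En n → En n) (x : En n) (i : Fin n) :
    defect V x i = (∑ k, jac V x i k * x k) - V x i := by
  rw [← fderiv_apply_eq_sum_jac]
  rfl

namespace RadialKernel

variable {φ g γ : En n → ℝ} {ρ : ℝ}

lemma isTest_moment (h : RadialKernel φ g γ ρ) (k : Fin n) : IsTest (fun x => g x * x k) ρ where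
  contDiff := h.isTest_weight.contDiff.mul (EuclideanSpace.proj (𝕜 := ℝ) k).contDiff
  eq_zero x hx := by rw [h.isTest_weight.eq_zero x hx, zero_mul]
  lt_one := h.isTest.lt_one

lemma fderiv_moment (h : RadialKernel φ g γ ρ) (i k : Fin n) (x : En n) :
    fderiv ℝ (fun x => g x * x k) x (EuclideanSpace.single i 1) =
      γ x * x i * x k + g x * if i = k then 1 else 0 := by
  have hg : DifferentiableAt ℝ g x := h.isTest_weight.contDiff.differentiable one_ne_zero x
  have hk : HasFDerivAt (fun x : En n => x k) (EuclideanSpace.proj (𝕜 := ℝ) k) x :=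
    (EuclideanSpace.proj (𝕜 := ℝ) k).hasFDerivAt
  rw [(hg.hasFDerivAt.fun_mul hk).fderiv]
  have hs : (EuclideanSpace.proj (𝕜 := ℝ) k) (EuclideanSpace.single i (1 : ℝ)) =
      if i = k then 1 else 0 := by
    simp [eq_comm]
  simp only [_root_.add_apply, _root_.smul_apply, h.fderiv_weight_apply, smul_eq_mul, hs]
  rw [inner_eq_sum]
  simp
  ring

end RadialKernel

namespace PotentialField

variable {φ g γ : En n → ℝ} {ρ : ℝ} {U : En n → ℝ} {V : En n → En n}

lemma lipUnit_component (h : PotentialField U V) (i : Fin n) : LipUnit (fun x => V x i) := by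
  obtain ⟨C, hC⟩ := h.lipschitz
  refine LipUnit.of_lipschitzWith (C := C) (LipschitzWith.of_dist_le_mul fun x y => ?_)
  refine le_trans ?_ (hC.dist_le_mul x y)
  rw [dist_eq_norm, dist_eq_norm]
  exact PiLp.norm_apply_le (V x - V y) i

lemma ae_differentiableAt (h : PotentialField U V) : ∀ᵐ x, DifferentiableAt ℝ V x := by
  obtain ⟨C, hC⟩ := h.lipschitz
  exact hC.ae_differentiableAt

lemma exists_norm_le (h : PotentialField U V) :
    ∃ M : ℝ, 0 ≤ M ∧ ∀ x ∈ ball (0 : En n) 1, ‖V x‖ ≤ M := by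
  obtain ⟨C, hC⟩ := h.lipschitz
  refine ⟨‖V 0‖ + C, by positivity, fun x hx => ?_⟩
  have h1 := hC.dist_le_mul x 0
  rw [dist_eq_norm, dist_zero_right] at h1
  have h2 : ‖x‖ < 1 := by simpa using hx
  have h3 : ‖V x‖ ≤ ‖V 0‖ + ‖V x - V 0‖ := by
    simpa using norm_add_le (V 0) (V x - V 0)
  nlinarith [C.2, mul_le_mul_of_nonneg_left h2.le C.2]

lemma lipUnit_potential (h : PotentialField U V) : LipUnit U := by
  obtain ⟨M, hM, hV⟩ := h.exists_norm_le
  refine ⟨M.toNNReal, (convex_ball (0 : En n) 1).lipschitzOnWith_of_nnnorm_hasFDerivWithin_le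
    (f' := fun x => innerSL ℝ (V x)) (fun x hx => (h.hasFDerivAt x hx).hasFDerivWithinAt)
    fun x hx => ?_⟩
  rw [← NNReal.coe_le_coe, coe_nnnorm, innerSL_apply_norm, Real.coe_toNNReal M hM]
  exact hV x hx

lemma jac_symm (h : PotentialField U V) {x : En n} (hx : x ∈ ball (0 : En n) 1)
    (hV : DifferentiableAt ℝ V x) (i j : Fin n) : jac V x i j = jac V x j i := by
  have h1 : ∀ᶠ y in 𝓝 x, HasFDerivAt U (innerSL ℝ (V y)) y :=
    eventually_of_mem (isOpen_ball.mem_nhds hx) h.hasFDerivAt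
  have h2 : HasFDerivAt (fun y => innerSL ℝ (V y)) ((innerSL ℝ).comp (fderiv ℝ V x)) x :=
    (innerSL ℝ).hasFDerivAt.comp x hV.hasFDerivAt
  have h3 := second_derivative_symmetric_of_eventually h1 h2
    (EuclideanSpace.single j 1) (EuclideanSpace.single i 1)
  simpa [jac, inner_eq_sum, Pi.single_apply] using h3

lemma divg_mul_apply {x : En n} (h : divg V x = 1 ∨ (V x = 0 ∧ fderiv ℝ V x = 0)) (j : Fin n) :
    divg V x * V x j = V x j := by
  rcases h with h | h
  · rw [h, one_mul]
  · simp [h.1]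

lemma divg_mul_defect {x : En n} (h : divg V x = 1 ∨ (V x = 0 ∧ fderiv ℝ V x = 0)) (j : Fin n) :
    divg V x * defect V x j = defect V x j := by
  rcases h with h | h
  · rw [h, one_mul]
  · simp [defect, h.1, h.2]

/-- First variation identity for a potential field against a radial kernel. -/
lemma zeroIntegral_first (h : PotentialField U V) (hk : RadialKernel φ g γ ρ) :
    ZeroIntegral volume (fun x => g x * (2 * inner ℝ x (V x) - n * ‖V x‖ ^ 2) -
      γ x * (‖x‖ ^ 2 * ‖V x‖ ^ 2 - inner ℝ x (V x) ^ 2) - φ x * divg V x -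
      g x * inner ℝ (V x) (defect V x)) := by
  have hA : ZeroIntegral volume (fun x => ∑ i : Fin n,
      (fderiv ℝ φ x (EuclideanSpace.single i 1) * V x i +
        φ x * fderiv ℝ (fun y => V y i) x (EuclideanSpace.single i 1))) :=
    ZeroIntegral.sum fun i _ => hk.isTest.zeroIntegral_fderiv_mul (h.lipUnit_component i) _
  have hB : ZeroIntegral volume (fun x => ∑ i : Fin n, ∑ j : Fin n,
      (fderiv ℝ (fun x => g x * x j) x (EuclideanSpace.single j 1) * (V x i * V x i) +
        g x * x j * fderiv ℝ (fun y => V y i * V y i) x (EuclideanSpace.single j 1))) :=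
    ZeroIntegral.sum fun i _ => ZeroIntegral.sum fun j _ =>
      (hk.isTest_moment j).zeroIntegral_fderiv_mul
        ((h.lipUnit_component i).mul (h.lipUnit_component i)) _
  have hC : ZeroIntegral volume (fun x => ∑ i : Fin n, ∑ j : Fin n,
      (fderiv ℝ (fun x => g x * x j) x (EuclideanSpace.single i 1) * (V x i * V x j) +
        g x * x j * fderiv ℝ (fun y => V y i * V y j) x (EuclideanSpace.single i 1))) :=
    ZeroIntegral.sum fun i _ => ZeroIntegral.sum fun j _ =>
      (hk.isTest_moment j).zeroIntegral_fderiv_mul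
        ((h.lipUnit_component i).mul (h.lipUnit_component j)) _
  refine ((hC.sub hB).sub hA).congr ?_
  filter_upwards [h.ae_differentiableAt, h.ae_divg] with x hd hx
  by_cases hb : x ∈ ball (0 : En n) 1
  · have hcomp := fun i => (differentiableAt_component hd i).hasFDerivAt
    have hmul : ∀ i j p, fderiv ℝ (fun y => V y i * V y j) x p =
        fderiv ℝ V x p i * V x j + V x i * fderiv ℝ V x p j := by
      intro i j p
      rw [((hcomp i).fun_mul (hcomp j)).fderiv]
      simp only [_root_.add_apply, _root_.smul_apply, smul_eq_mul, fderiv_component hd]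
      ring
    have key := sum_radial_first_variation (φ := φ x) (g := g x) (γ := γ x) (fun i => x i)
      (fun i => V x i) (jac V x) (h.jac_symm hb hd) (divg_mul_apply (hx hb))
    simp only [hk.fderiv_moment, hmul, fderiv_component hd, hk.fderiv_apply]
    simp only [← real_inner_self_eq_norm_sq, inner_eq_sum, defect_apply]
    refine Eq.trans ?_ key
    simp [jac, mul_assoc]
  · have hρ : ρ ≤ ‖x‖ := hk.isTest.lt_one.le.trans (by simpa using hb)
    simp [hk.isTest.eq_zero x hρ, hk.isTest_weight.eq_zero x hρ, hk.second_eq_zero x hρ,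
      hk.fderiv_moment, hk.fderiv_apply]

/-- Second variation identity for a potential field against a radial kernel. -/
lemma zeroIntegral_second (h : PotentialField U V) (hk : RadialKernel φ g γ ρ) :
    ZeroIntegral volume (fun x => g x * (inner ℝ x (defect V x) - n * inner ℝ (V x) (defect V x) -
        ‖defect V x‖ ^ 2) -
      γ x * (‖x‖ ^ 2 * inner ℝ (V x) (defect V x) -
        inner ℝ x (defect V x) * inner ℝ x (V x))) := by
  set ω : En n → ℝ := fun x => ∑ k, x k * V x k - 2 * U x with hω
  have hcoord : ∀ k : Fin n, LipUnit (fun x : En n => x k) := fun k =>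
    LipUnit.of_lipschitzWith (EuclideanSpace.proj (𝕜 := ℝ) k).lipschitz
  have hωL : LipUnit ω :=
    (LipUnit.sum fun k _ => (hcoord k).mul (h.lipUnit_component k)).sub
      ((LipUnit.const 2).mul h.lipUnit_potential)
  have hS1 : ZeroIntegral volume (fun x => ∑ i : Fin n, ∑ k : Fin n,
      ((fderiv ℝ (fun x => g x * x k) x (EuclideanSpace.single i 1) * ω x +
        g x * x k * fderiv ℝ ω x (EuclideanSpace.single i 1)) *
          fderiv ℝ (fun y => V y i) x (EuclideanSpace.single k 1) -
      (fderiv ℝ (fun x => g x * x k) x (EuclideanSpace.single k 1) * ω x +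
        g x * x k * fderiv ℝ ω x (EuclideanSpace.single k 1)) *
          fderiv ℝ (fun y => V y i) x (EuclideanSpace.single i 1))) :=
    ZeroIntegral.sum fun i _ => ZeroIntegral.sum fun k _ =>
      (hk.isTest_moment k).zeroIntegral_fderiv_mul_fderiv_comm hωL (h.lipUnit_component i) _ _
  have hS2 : ZeroIntegral volume (fun x => ∑ i : Fin n, ∑ k : Fin n,
      ((fderiv ℝ (fun x => g x * x i) x (EuclideanSpace.single k 1) * 1 +
        g x * x i * fderiv ℝ (fun _ : En n => (1 : ℝ)) x (EuclideanSpace.single k 1)) *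
          fderiv ℝ (fun y => ω y * V y k) x (EuclideanSpace.single i 1) -
      (fderiv ℝ (fun x => g x * x i) x (EuclideanSpace.single i 1) * 1 +
        g x * x i * fderiv ℝ (fun _ : En n => (1 : ℝ)) x (EuclideanSpace.single i 1)) *
          fderiv ℝ (fun y => ω y * V y k) x (EuclideanSpace.single k 1))) :=
    ZeroIntegral.sum fun i _ => ZeroIntegral.sum fun k _ =>
      (hk.isTest_moment i).zeroIntegral_fderiv_mul_fderiv_comm (LipUnit.const 1)
        (hωL.mul (h.lipUnit_component k)) _ _
  refine (hS2.sub hS1).congr ?_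
  filter_upwards [h.ae_differentiableAt, h.ae_divg] with x hd hx
  by_cases hb : x ∈ ball (0 : En n) 1
  · have hcomp := fun i => (differentiableAt_component hd i).hasFDerivAt
    have hinner : (fun y => ∑ k, y k * V y k) = fun y => inner ℝ y (V y) :=
      funext fun y => (inner_eq_sum y (V y)).symm
    have hωd : HasFDerivAt ω _ x :=
      (hinner ▸ (hasFDerivAt_id x).inner ℝ hd.hasFDerivAt).sub ((h.hasFDerivAt x hb).const_mul 2)
    have hωe : ∀ i, fderiv ℝ ω x (EuclideanSpace.single i 1) = defect V x i := by
      intro i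
      rw [hωd.fderiv, defect_apply]
      simp only [fun k => h.jac_symm hb hd i k]
      simp [fderivInnerCLM_apply, inner_eq_sum, jac, mul_comm]
      ring
    have hmul : ∀ k i, fderiv ℝ (fun y => ω y * V y k) x (EuclideanSpace.single i 1) =
        defect V x i * V x k + ω x * jac V x k i := by
      intro k i
      rw [(hωd.differentiableAt.hasFDerivAt.fun_mul (hcomp k)).fderiv]
      simp only [_root_.add_apply, _root_.smul_apply, smul_eq_mul, fderiv_component hd, hωe, jac]
      ring
    have key := sum_radial_second_variation (g := g x) (γ := γ x) (ω := ω x) (fun i => x i)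
      (fun i => V x i) (fun i => defect V x i) (jac V x) (h.jac_symm hb hd) (defect_apply V x)
      (divg_mul_defect (hx hb))
    simp only [hk.fderiv_moment, hmul, hωe, fderiv_component hd]
    simp only [← real_inner_self_eq_norm_sq, real_inner_comm (defect V x) (V x)]
    simp only [inner_eq_sum]
    refine Eq.trans ?_ key
    simp [jac]
  · have hρ : ρ ≤ ‖x‖ := hk.isTest.lt_one.le.trans (by simpa using hb)
    simp [hk.isTest_weight.eq_zero x hρ, hk.second_eq_zero x hρ, hk.fderiv_moment]

end PotentialField

end RadialKernels

section GradientField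

variable {n : ℕ}

lemma LipschitzWith.ae_fderiv_eq_zero {V : En n → En n} {C : NNReal} (hV : LipschitzWith C V) :
    ∀ᵐ x, V x = 0 → fderiv ℝ V x = 0 := by
  set s : Set (En n) := {x | V x = 0} ∩ {x | DifferentiableAt ℝ V x} with hs
  have hmeas : MeasurableSet s :=
    (isClosed_eq hV.continuous continuous_const).measurableSet.inter
      (measurableSet_of_differentiableAt ℝ V)
  have happ : ApproximatesLinearOn V (0 : En n →L[ℝ] En n) s 0 := by
    intro x hx y hy
    have h1 : V x = 0 := hx.1
    have h2 : V y = 0 := hy.1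
    simp [h1, h2]
  have h := happ.norm_fderiv_sub_le volume hmeas (fderiv ℝ V)
    fun x hx => hx.2.hasFDerivAt.hasFDerivWithinAt
  rw [ae_restrict_iff' hmeas] at h
  filter_upwards [h, hV.ae_differentiableAt] with x hx hd h0
  simpa using hx ⟨h0, hd⟩

lemma trace_eq_divg (V : En n → En n) (x : En n) :
    LinearMap.trace ℝ (En n) (fderiv ℝ V x : En n →ₗ[ℝ] En n) = divg V x := by
  rw [LinearMap.trace_eq_matrix_trace ℝ (EuclideanSpace.basisFun (Fin n) ℝ).toBasis]
  simp [Matrix.trace, LinearMap.toMatrix_apply, divg, jac]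

/-- The gradient of a solution extends to a global Lipschitz potential field. -/
lemma SolutionHyp.exists_potentialField {u : En n → ℝ} (hu : SolutionHyp u) :
    ∃ V : En n → En n, PotentialField u V ∧ V 0 = 0 ∧
      ∀ x ∈ ball (0 : En n) 1, gradient u x = V x := by
  obtain ⟨hdiff, ⟨L, hL⟩, hae, -, h0⟩ := hu
  obtain ⟨V, hV, hVeq⟩ := hL.extend_finite_dimension
  rw [ae_restrict_iff' measurableSet_ball] at hae
  refine ⟨V, ⟨⟨_, hV⟩, fun x hx => ?_, ?_⟩, ?_, hVeq⟩
  · have h := (hdiff x hx).hasGradientAt.hasFDerivAt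
    have e : InnerProductSpace.toDual ℝ (En n) (gradient u x) = innerSL ℝ (V x) := by
      rw [show gradient u x = V x from hVeq hx]
      rfl
    rwa [e] at h
  · filter_upwards [hae, hV.ae_fderiv_eq_zero] with x hx hz hb
    obtain ⟨D, hD, -, htr⟩ := hx hb
    by_cases hv : V x = 0
    · exact Or.inr ⟨hv, hz hv⟩
    · left
      have hev : V =ᶠ[𝓝 x] fun y => gradient u y :=
        eventually_of_mem (isOpen_ball.mem_nhds hb) fun y hy => (hVeq hy).symm
      rw [← trace_eq_divg, (hD.congr_of_eventuallyEq hev).fderiv]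
      exact htr fun h => hv (by rw [← hVeq hb]; exact h)
  · rw [← hVeq (mem_ball_self one_pos)]
    exact h0

end GradientField

section StandardKernel

lemma deriv_eq_zero_of_eq_zero_on_Iic {F : ℝ → ℝ} {a t : ℝ} (hF : DifferentiableAt ℝ F t)
    (h : ∀ x ≤ a, F x = 0) (ht : t ≤ a) : deriv F t = 0 := by
  have h1 : HasDerivWithinAt F (deriv F t) (Set.Iic t) t := hF.hasDerivAt.hasDerivWithinAt
  have h2 : HasDerivWithinAt F 0 (Set.Iic t) t :=
    (hasDerivWithinAt_const t (Set.Iic t) (0 : ℝ)).congr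
      (fun x hx => h x (le_trans hx ht)) (h t ht)
  exact (uniqueDiffOn_Iic t t Set.self_mem_Iic).eq_deriv _ h1 h2

lemma expNegInvGlue_contDiff_deriv : ContDiff ℝ 2 (deriv expNegInvGlue) :=
  (contDiff_succ_iff_deriv (n := 2).1 (expNegInvGlue.contDiff (n := 3))).2.2

lemma expNegInvGlue_deriv_eq_zero {t : ℝ} (ht : t ≤ 0) : deriv expNegInvGlue t = 0 :=
  deriv_eq_zero_of_eq_zero_on_Iic
    ((expNegInvGlue.contDiff (n := 1)).differentiable one_ne_zero t)
    (fun _ hx => expNegInvGlue.zero_of_nonpos hx) ht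

variable {n : ℕ}

/-- A smooth radially decreasing bump function supported in the unit ball. -/
def bump (x : En n) : ℝ := expNegInvGlue (1 - ‖x‖ ^ 2)

/-- The weight with `∇ bump = -bumpWeight x`. -/
def bumpWeight (x : En n) : ℝ := 2 * deriv expNegInvGlue (1 - ‖x‖ ^ 2)

/-- The function with `∇ bumpWeight = bumpSecond x`. -/
def bumpSecond (x : En n) : ℝ := -4 * deriv (deriv expNegInvGlue) (1 - ‖x‖ ^ 2)

lemma one_sub_sq_nonpos {x : En n} (hx : 1 ≤ ‖x‖) : 1 - ‖x‖ ^ 2 ≤ 0 := by nlinarith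

lemma bump_eq_zero {x : En n} (hx : 1 ≤ ‖x‖) : bump x = 0 :=
  expNegInvGlue.zero_of_nonpos (one_sub_sq_nonpos hx)

lemma bumpWeight_eq_zero {x : En n} (hx : 1 ≤ ‖x‖) : bumpWeight x = 0 := by
  rw [bumpWeight, expNegInvGlue_deriv_eq_zero (one_sub_sq_nonpos hx), mul_zero]

lemma bumpSecond_eq_zero {x : En n} (hx : 1 ≤ ‖x‖) : bumpSecond x = 0 := by
  rw [bumpSecond, deriv_eq_zero_of_eq_zero_on_Iic
    (expNegInvGlue_contDiff_deriv.differentiable two_ne_zero _)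
    (fun _ h => expNegInvGlue_deriv_eq_zero h) (one_sub_sq_nonpos hx), mul_zero]

lemma bump_nonneg (x : En n) : 0 ≤ bump x := expNegInvGlue.nonneg _

lemma bumpWeight_nonneg (x : En n) : 0 ≤ bumpWeight x :=
  mul_nonneg two_pos.le (expNegInvGlue.monotone.deriv_nonneg)

lemma contDiff_one_sub_norm_sq {m : WithTop ℕ∞} : ContDiff ℝ m (fun x : En n => 1 - ‖x‖ ^ 2) :=
  contDiff_const.sub (contDiff_norm_sq ℝ)

lemma contDiff_bump : ContDiff ℝ 1 (bump : En n → ℝ) :=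
  (expNegInvGlue.contDiff (n := 1)).comp contDiff_one_sub_norm_sq

lemma contDiff_bumpWeight : ContDiff ℝ 1 (bumpWeight : En n → ℝ) :=
  contDiff_const.mul ((expNegInvGlue_contDiff_deriv.of_le one_le_two).comp
    contDiff_one_sub_norm_sq)

lemma continuous_bumpSecond : Continuous (bumpSecond : En n → ℝ) :=
  continuous_const.mul ((expNegInvGlue_contDiff_deriv.continuous_deriv one_le_two).comp
    (contDiff_one_sub_norm_sq (m := 0)).continuous)

lemma fderiv_comp_one_sub_norm_sq {F : ℝ → ℝ} (hF : Differentiable ℝ F) (c : ℝ) (x p : En n) :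
    fderiv ℝ (fun y : En n => c * F (1 - ‖y‖ ^ 2)) x p =
      c * deriv F (1 - ‖x‖ ^ 2) * (-2 * inner ℝ x p) := by
  have h1 : HasFDerivAt (fun y : En n => 1 - ‖y‖ ^ 2) (-(2 • innerSL ℝ x)) x :=
    (hasStrictFDerivAt_norm_sq x).hasFDerivAt.const_sub 1
  have h2 := ((hF _).hasDerivAt.comp_hasFDerivAt x h1).const_mul c
  rw [show (fun y : En n => c * F (1 - ‖y‖ ^ 2)) =
    fun y => c * (F ∘ fun y : En n => 1 - ‖y‖ ^ 2) y from rfl, h2.fderiv]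
  simp
  ring

lemma fderiv_bump (x p : En n) : fderiv ℝ bump x p = -bumpWeight x * inner ℝ x p := by
  have h := fderiv_comp_one_sub_norm_sq
    ((expNegInvGlue.contDiff (n := 1)).differentiable one_ne_zero) 1 x p
  simp only [one_mul] at h
  rw [show (bump : En n → ℝ) = fun y => expNegInvGlue (1 - ‖y‖ ^ 2) from rfl, h, bumpWeight]
  ring

lemma fderiv_bumpWeight (x p : En n) :
    fderiv ℝ bumpWeight x p = bumpSecond x * inner ℝ x p := by
  have h := fderiv_comp_one_sub_norm_sq
    (expNegInvGlue_contDiff_deriv.differentiable two_ne_zero) 2 x p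
  rw [show (bumpWeight : En n → ℝ) = fun y => 2 * deriv expNegInvGlue (1 - ‖y‖ ^ 2) from rfl, h,
    bumpSecond]
  ring

lemma fderiv_const_mul_comp_smul {F : En n → ℝ} (hF : Differentiable ℝ F) (a c : ℝ) (x p : En n) :
    fderiv ℝ (fun y => c * F (a • y)) x p = c * a * fderiv ℝ F (a • x) p := by
  have h1 : HasFDerivAt (fun y : En n => a • y) (a • ContinuousLinearMap.id ℝ (En n)) x :=
    (hasFDerivAt_id x).const_smul a
  have h2 := ((hF (a • x)).hasFDerivAt.comp x h1).const_mul c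
  rw [show (fun y => c * F (a • y)) = fun y => c * (F ∘ fun y : En n => a • y) y from rfl,
    h2.fderiv]
  simp
  ring

lemma one_le_norm_inv_smul {s : ℝ} (hs : 0 < s) {x : En n} (hx : s ≤ ‖x‖) : 1 ≤ ‖s⁻¹ • x‖ := by
  rw [norm_smul, norm_inv, Real.norm_of_nonneg hs.le]
  rwa [← div_eq_inv_mul, one_le_div hs]

/-- The rescaled bump kernel. -/
lemma radialKernel_bump {s : ℝ} (hs : 0 < s) (hs1 : s < 1) :
    RadialKernel (n := n) (fun x => bump (s⁻¹ • x)) (fun x => s⁻¹ ^ 2 * bumpWeight (s⁻¹ • x))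
      (fun x => s⁻¹ ^ 4 * bumpSecond (s⁻¹ • x)) s where
  isTest := ⟨contDiff_bump.comp (contDiff_const_smul s⁻¹),
    fun x hx => bump_eq_zero (one_le_norm_inv_smul hs hx), hs1⟩
  isTest_weight := ⟨contDiff_const.mul (contDiff_bumpWeight.comp (contDiff_const_smul s⁻¹)),
    fun x hx => by rw [bumpWeight_eq_zero (one_le_norm_inv_smul hs hx), mul_zero], hs1⟩
  fderiv_apply x p := by
    have h := fderiv_const_mul_comp_smul (contDiff_bump.differentiable one_ne_zero) s⁻¹ 1 x p
    simp only [one_mul] at h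
    rw [h, fderiv_bump, real_inner_smul_left]
    ring
  fderiv_weight_apply x p := by
    rw [fderiv_const_mul_comp_smul (contDiff_bumpWeight.differentiable one_ne_zero),
      fderiv_bumpWeight, real_inner_smul_left]
    ring
  continuous_second := continuous_const.mul (continuous_bumpSecond.comp (continuous_const_smul s⁻¹))
  second_eq_zero x hx := by rw [bumpSecond_eq_zero (one_le_norm_inv_smul hs hx), mul_zero]

end StandardKernel

section Scaling

variable {n : ℕ}

lemma ae_comp_smul {P : En n → Prop} (h : ∀ᵐ y, P y) {s : ℝ} (hs : s ≠ 0) :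
    ∀ᵐ x : En n, P (s • x) := by
  rw [ae_iff] at h ⊢
  have := Measure.addHaar_preimage_smul (volume : Measure (En n)) hs {y | ¬P y}
  rw [h, mul_zero] at this
  exact this

lemma ZeroIntegral.comp_smul {f : En n → ℝ} (h : ZeroIntegral volume f) {s : ℝ} (hs : s ≠ 0) :
    ZeroIntegral volume (fun x => f (s • x)) :=
  ⟨h.1.comp_smul hs, by rw [Measure.integral_comp_smul, h.2, smul_zero]⟩

lemma continuous_integrable {k : En n → ℝ} (hk : Continuous k) (hk0 : ∀ x, 1 ≤ ‖x‖ → k x = 0) :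
    Integrable k :=
  hk.integrable_of_hasCompactSupport (HasCompactSupport.intro (isCompact_closedBall (0 : En n) 1)
    fun x hx => hk0 x (by simpa using (not_le.1 fun h => hx (by simpa using h)).le))

lemma smul_mem_ball {s : ℝ} (hs : 0 < s) (hs1 : s < 1) {x : En n} (hx : ‖x‖ < 1) :
    s • x ∈ ball (0 : En n) 1 := by
  rw [mem_ball_zero_iff, norm_smul, Real.norm_of_nonneg hs.le]
  nlinarith [norm_nonneg x]

/-- Differentiation under the integral of a dilated Lipschitz function. -/
lemma LipUnit.hasDerivAt_integral_dilation {k Q : En n → ℝ} (hk : Continuous k)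
    (hk0 : ∀ x, 1 ≤ ‖x‖ → k x = 0) (hQ : LipUnit Q) (hQc : Continuous Q) {s : ℝ} (hs : 0 < s)
    (hs1 : s < 1) :
    Integrable (fun x => k x * fderiv ℝ Q (s • x) x) ∧
      HasDerivAt (fun σ => ∫ x, k x * Q (σ • x)) (∫ x, k x * fderiv ℝ Q (s • x) x) s := by
  obtain ⟨C, hC0, hC⟩ := hQ.abs_sub_le
  have hI := continuous_integrable hk hk0
  refine hasDerivAt_integral_of_dominated_loc_of_lip (μ := volume)
    (F := fun σ x => k x * Q (σ • x)) (bound := fun x => |k x| * C)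
    (Ioo_mem_nhds hs hs1) ?_ ?_ ?_ ?_ (hI.abs.mul_const C) ?_
  · exact Eventually.of_forall fun σ =>
      (hk.mul (hQc.comp (continuous_const_smul σ))).aestronglyMeasurable
  · exact continuous_integrable (hk.mul (hQc.comp (continuous_const_smul s)))
      fun x hx => by simp [hk0 x hx]
  · refine (hk.measurable.mul ?_).aestronglyMeasurable
    have h1 : Measurable fun x : En n => fderiv ℝ Q (s • x) :=
      (measurable_fderiv ℝ Q).comp (measurable_const_smul s)
    exact (isBoundedBilinearMap_apply (𝕜 := ℝ) (E := En n) (F := ℝ)).continuous.measurable.comp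
      (h1.prodMk measurable_id)
  · refine Eventually.of_forall fun x => LipschitzOnWith.of_dist_le_mul fun σ hσ τ hτ => ?_
    rw [Real.dist_eq, Real.dist_eq, ← mul_sub, abs_mul, Real.coe_nnabs,
      abs_of_nonneg (mul_nonneg (abs_nonneg (k x)) hC0)]
    rcases lt_or_ge ‖x‖ 1 with hx | hx
    · rw [mul_assoc]
      refine mul_le_mul_of_nonneg_left ?_ (abs_nonneg _)
      refine (hC _ (smul_mem_ball hσ.1 hσ.2 hx) _ (smul_mem_ball hτ.1 hτ.2 hx)).trans ?_
      rw [dist_eq_norm, ← sub_smul, norm_smul, Real.norm_eq_abs]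
      refine mul_le_mul_of_nonneg_left ?_ hC0
      nlinarith [abs_nonneg (σ - τ), norm_nonneg x]
    · simp [hk0 x hx]
  · filter_upwards [ae_comp_smul (hQ.ae_differentiableAt (μ := volume)) hs.ne'] with x hx
    rcases lt_or_ge ‖x‖ 1 with h1 | h1
    · have h2 : HasDerivAt (fun σ : ℝ => σ • x) x s := by
        simpa using (hasDerivAt_id s).smul_const x
      exact ((hx (smul_mem_ball hs hs1 h1)).hasFDerivAt.comp_hasDerivAt s h2).const_mul (k x)
    · simpa [hk0 x h1] using hasDerivAt_const s (0 : ℝ)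

end Scaling

section Monotonicity

variable {n : ℕ}

/-- Differentiation of homogeneously rescaled weighted averages. -/
lemma LipUnit.hasDerivAt_homogeneous {k Q : En n → ℝ} (hk : Continuous k)
    (hk0 : ∀ x, 1 ≤ ‖x‖ → k x = 0) (hQ : LipUnit Q) (hQc : Continuous Q) (m : ℕ) {s : ℝ}
    (hs : 0 < s) (hs1 : s < 1) :
    Integrable (fun x => s⁻¹ ^ m * (k x * (fderiv ℝ Q (s • x) (s • x) - m * Q (s • x)))) ∧
      HasDerivAt (fun σ => σ⁻¹ ^ m * ∫ x, k x * Q (σ • x))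
        (s⁻¹ * ∫ x, s⁻¹ ^ m * (k x * (fderiv ℝ Q (s • x) (s • x) - m * Q (s • x)))) s := by
  obtain ⟨hI, hD⟩ := hQ.hasDerivAt_integral_dilation hk hk0 hQc hs hs1
  have hI0 : Integrable fun x => k x * Q (s • x) :=
    continuous_integrable (hk.mul (hQc.comp (continuous_const_smul s)))
      fun x hx => by simp [hk0 x hx]
  have he : (fun x => s⁻¹ ^ m * (k x * (fderiv ℝ Q (s • x) (s • x) - m * Q (s • x)))) =
      fun x => s⁻¹ ^ m * s * (k x * fderiv ℝ Q (s • x) x) -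
        s⁻¹ ^ m * m * (k x * Q (s • x)) := by
    funext x
    rw [map_smul, smul_eq_mul]
    ring
  rw [he]
  refine ⟨(hI.const_mul _).sub (hI0.const_mul _), ?_⟩
  rw [integral_sub (hI.const_mul _) (hI0.const_mul _), integral_const_mul, integral_const_mul]
  refine (((hasDerivAt_inv hs.ne').fun_pow m).fun_mul hD).congr_deriv ?_
  rcases m with _ | m
  · simp [hs.ne']
  · simp only [Nat.add_sub_cancel, pow_succ s⁻¹ m]
    generalize s⁻¹ ^ m = c
    field_simp
    ring

lemma ZeroIntegral.integral_sub_nonneg {a b T : En n → ℝ} (hT : ZeroIntegral volume T)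
    (ha : Integrable a) (hb : Integrable b) (h : ∀ᵐ x, 2 * T x ≤ a x - b x) :
    0 ≤ (∫ x, a x) - ∫ x, b x := by
  rw [← integral_sub ha hb]
  have h1 := integral_mono_ae (hT.1.const_mul 2) (ha.sub hb) h
  rw [integral_const_mul, hT.2, mul_zero] at h1
  exact h1

/-- The quadratic quantity paired with the weight in the first variation. -/
def pairQ (V : En n → En n) (y : En n) : ℝ := 2 * inner ℝ y (V y) - n * ‖V y‖ ^ 2

/-- The squared norm of the tangential part of a field, scaled by the squared radius. -/
def crossQ (V : En n → En n) (y : En n) : ℝ := ‖y‖ ^ 2 * ‖V y‖ ^ 2 - inner ℝ y (V y) ^ 2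

/-- The smoothed, rescaled quadratic energy. -/
def weissJ (V : En n → En n) (s : ℝ) : ℝ :=
  s⁻¹ ^ 2 * (∫ x, bumpWeight x * pairQ V (s • x)) -
    s⁻¹ ^ 4 * ∫ x, bumpSecond x * crossQ V (s • x)

/-- The smoothed, rescaled `L²` norm of a field. -/
def heightH (V : En n → En n) (s : ℝ) : ℝ := s⁻¹ ^ 2 * ∫ x, bumpWeight x * ‖V (s • x)‖ ^ 2

section Pointwise

variable {V : En n → En n} {y : En n}

lemma fderiv_inner_self (hV : DifferentiableAt ℝ V y) :
    HasFDerivAt (fun z => inner ℝ z (V z)) (fderiv ℝ (fun z => inner ℝ z (V z)) y) y ∧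
      fderiv ℝ (fun z => inner ℝ z (V z)) y y =
        2 * inner ℝ y (V y) + inner ℝ y (defect V y) := by
  have h : HasFDerivAt (fun z => inner ℝ z (V z)) _ y :=
    (hasFDerivAt_id y).inner ℝ hV.hasFDerivAt
  refine ⟨h.differentiableAt.hasFDerivAt, ?_⟩
  rw [h.fderiv]
  simp [fderivInnerCLM_apply, defect, inner_sub_right]
  ring

lemma fderiv_norm_sq_self (hV : DifferentiableAt ℝ V y) :
    HasFDerivAt (fun z => ‖V z‖ ^ 2) (fderiv ℝ (fun z => ‖V z‖ ^ 2) y) y ∧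
      fderiv ℝ (fun z => ‖V z‖ ^ 2) y y = 2 * ‖V y‖ ^ 2 + 2 * inner ℝ (V y) (defect V y) := by
  have h := hV.hasFDerivAt.norm_sq
  refine ⟨h.differentiableAt.hasFDerivAt, ?_⟩
  rw [h.fderiv]
  simp [defect, inner_sub_right]
  ring

lemma fderiv_pairQ_self (hV : DifferentiableAt ℝ V y) :
    fderiv ℝ (pairQ V) y y = 2 * pairQ V y +
      2 * (inner ℝ y (defect V y) - n * inner ℝ (V y) (defect V y)) := by
  have h := ((fderiv_inner_self hV).1.const_mul 2).sub ((fderiv_norm_sq_self hV).1.const_mul n)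
  have h' : fderiv ℝ (pairQ V) y = _ := h.fderiv
  rw [h']
  simp [(fderiv_inner_self hV).2, (fderiv_norm_sq_self hV).2, pairQ]
  ring

lemma fderiv_crossQ_self (hV : DifferentiableAt ℝ V y) :
    fderiv ℝ (crossQ V) y y = 4 * crossQ V y +
      2 * (‖y‖ ^ 2 * inner ℝ (V y) (defect V y) -
        inner ℝ y (defect V y) * inner ℝ y (V y)) := by
  have h := ((hasStrictFDerivAt_norm_sq y).hasFDerivAt.fun_mul (fderiv_norm_sq_self hV).1).sub
    ((fderiv_inner_self hV).1.fun_mul (fderiv_inner_self hV).1)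
  have e : crossQ V = (fun z => ‖z‖ ^ 2 * ‖V z‖ ^ 2) -
      fun z => inner ℝ z (V z) * inner ℝ z (V z) := by
    funext z
    simp [crossQ, sq]
  rw [← e] at h
  rw [h.fderiv]
  simp [(fderiv_inner_self hV).2, (fderiv_norm_sq_self hV).2, crossQ]
  ring

end Pointwise

namespace PotentialField

variable {U : En n → ℝ} {V : En n → En n}

lemma continuous (h : PotentialField U V) : Continuous V := by
  obtain ⟨C, hC⟩ := h.lipschitz
  exact hC.continuous

lemma lipUnit_norm_sq (h : PotentialField U V) : LipUnit (fun y => ‖V y‖ ^ 2) := by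
  simp only [← real_inner_self_eq_norm_sq, inner_eq_sum]
  exact LipUnit.sum fun i _ => (h.lipUnit_component i).mul (h.lipUnit_component i)

lemma lipUnit_inner (h : PotentialField U V) : LipUnit (fun y => inner ℝ y (V y)) := by
  simp only [inner_eq_sum]
  exact LipUnit.sum fun i _ =>
    (LipUnit.of_lipschitzWith (EuclideanSpace.proj (𝕜 := ℝ) i).lipschitz).mul
      (h.lipUnit_component i)

lemma lipUnit_pairQ (h : PotentialField U V) : LipUnit (pairQ V) :=
  ((LipUnit.const 2).mul h.lipUnit_inner).sub ((LipUnit.const n).mul h.lipUnit_norm_sq)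

lemma lipUnit_crossQ (h : PotentialField U V) : LipUnit (crossQ V) := by
  have h1 : LipUnit (fun y : En n => ‖y‖) := LipUnit.of_lipschitzWith lipschitzWith_one_norm
  have h2 := ((h1.mul h1).mul h.lipUnit_norm_sq).sub (h.lipUnit_inner.mul h.lipUnit_inner)
  simp only [← sq] at h2
  exact h2

lemma continuous_pairQ (h : PotentialField U V) : Continuous (pairQ V) :=
  (continuous_const.mul (continuous_id.inner h.continuous)).sub
    (continuous_const.mul (h.continuous.norm.pow 2))

lemma continuous_crossQ (h : PotentialField U V) : Continuous (crossQ V) :=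
  ((continuous_norm.pow 2).mul (h.continuous.norm.pow 2)).sub
    ((continuous_id.inner h.continuous).pow 2)

lemma scaled_first (h : PotentialField U V) {s : ℝ} (hs : 0 < s) (hs1 : s < 1) :
    ZeroIntegral volume (fun x => s⁻¹ ^ 2 * bumpWeight x * pairQ V (s • x) -
      s⁻¹ ^ 4 * bumpSecond x * crossQ V (s • x) - bump x * divg V (s • x) -
      s⁻¹ ^ 2 * bumpWeight x * inner ℝ (V (s • x)) (defect V (s • x))) := by
  have h1 := (h.zeroIntegral_first (radialKernel_bump hs hs1)).comp_smul hs.ne'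
  simp only [inv_smul_smul₀ hs.ne'] at h1
  exact h1

lemma scaled_second (h : PotentialField U V) {s : ℝ} (hs : 0 < s) (hs1 : s < 1) :
    ZeroIntegral volume (fun x => s⁻¹ ^ 2 * bumpWeight x * (inner ℝ (s • x) (defect V (s • x)) -
        n * inner ℝ (V (s • x)) (defect V (s • x)) - ‖defect V (s • x)‖ ^ 2) -
      s⁻¹ ^ 4 * bumpSecond x * (‖s • x‖ ^ 2 * inner ℝ (V (s • x)) (defect V (s • x)) -
        inner ℝ (s • x) (defect V (s • x)) * inner ℝ (s • x) (V (s • x)))) := by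
  have h1 := (h.zeroIntegral_second (radialKernel_bump hs hs1)).comp_smul hs.ne'
  simpa only [inv_smul_smul₀ hs.ne'] using h1

lemma exists_hasDerivAt_weissJ (h : PotentialField U V) {s : ℝ} (hs : 0 < s) (hs1 : s < 1) :
    ∃ J', 0 ≤ J' ∧ HasDerivAt (weissJ V) J' s := by
  obtain ⟨hI1, hD1⟩ := h.lipUnit_pairQ.hasDerivAt_homogeneous contDiff_bumpWeight.continuous
    (fun _ => bumpWeight_eq_zero) h.continuous_pairQ 2 hs hs1
  obtain ⟨hI2, hD2⟩ := h.lipUnit_crossQ.hasDerivAt_homogeneous continuous_bumpSecond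
    (fun _ => bumpSecond_eq_zero) h.continuous_crossQ 4 hs hs1
  refine ⟨_, ?_, hD1.sub hD2⟩
  rw [← mul_sub]
  refine mul_nonneg (inv_pos.2 hs).le ((h.scaled_second hs hs1).integral_sub_nonneg hI1 hI2 ?_)
  filter_upwards [ae_comp_smul h.ae_differentiableAt hs.ne'] with x hx
  rw [fderiv_pairQ_self hx, fderiv_crossQ_self hx]
  have hp : 0 ≤ 2 * (s⁻¹ ^ 2 * bumpWeight x * ‖defect V (s • x)‖ ^ 2) :=
    mul_nonneg two_pos.le (mul_nonneg (mul_nonneg (by positivity) (bumpWeight_nonneg x))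
      (by positivity))
  push_cast
  linarith

lemma monotoneOn_weissJ (h : PotentialField U V) : MonotoneOn (weissJ V) (Set.Ioo 0 1) := by
  refine monotoneOn_of_deriv_nonneg (convex_Ioo 0 1) (fun s hs => ?_) (fun s hs => ?_)
    fun s hs => ?_
  · obtain ⟨J', -, hJ⟩ := h.exists_hasDerivAt_weissJ hs.1 hs.2
    exact hJ.continuousAt.continuousWithinAt
  · rw [interior_Ioo] at hs
    obtain ⟨J', -, hJ⟩ := h.exists_hasDerivAt_weissJ hs.1 hs.2
    exact hJ.differentiableAt.differentiableWithinAt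
  · rw [interior_Ioo] at hs
    obtain ⟨J', h0, hJ⟩ := h.exists_hasDerivAt_weissJ hs.1 hs.2
    rwa [hJ.deriv]

/-- The derivative of the height in terms of the energy and the divergence. -/
lemma hasDerivAt_heightH (h : PotentialField U V) {s : ℝ} (hs : 0 < s) (hs1 : s < 1) :
    Integrable (fun x => bump x * divg V (s • x)) ∧
      HasDerivAt (heightH V)
        (2 * s⁻¹ * (weissJ V s - ∫ x, bump x * divg V (s • x))) s := by
  obtain ⟨hI, hD⟩ := h.lipUnit_norm_sq.hasDerivAt_homogeneous contDiff_bumpWeight.continuous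
    (fun _ => bumpWeight_eq_zero) (h.continuous.norm.pow 2) 2 hs hs1
  have hG1 : Integrable fun x => bumpWeight x * pairQ V (s • x) :=
    continuous_integrable (contDiff_bumpWeight.continuous.mul
      (h.continuous_pairQ.comp (continuous_const_smul s)))
      fun x hx => by simp [bumpWeight_eq_zero hx]
  have hG2 : Integrable fun x => bumpSecond x * crossQ V (s • x) :=
    continuous_integrable (continuous_bumpSecond.mul
      (h.continuous_crossQ.comp (continuous_const_smul s)))
      fun x hx => by simp [bumpSecond_eq_zero hx]
  have hae : (fun x => s⁻¹ ^ 2 * (bumpWeight x *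
      (fderiv ℝ (fun y => ‖V y‖ ^ 2) (s • x) (s • x) - (2 : ℕ) * ‖V (s • x)‖ ^ 2))) =ᵐ[volume]
      fun x => 2 * (s⁻¹ ^ 2 * bumpWeight x * inner ℝ (V (s • x)) (defect V (s • x))) := by
    filter_upwards [ae_comp_smul h.ae_differentiableAt hs.ne'] with x hx
    rw [(fderiv_norm_sq_self hx).2]
    push_cast
    ring
  have hI' : Integrable fun x =>
      s⁻¹ ^ 2 * bumpWeight x * inner ℝ (V (s • x)) (defect V (s • x)) := by
    have := (hI.congr hae).const_mul 2⁻¹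
    simpa using this
  have h1 := h.scaled_first hs hs1
  have hG := (hG1.const_mul (s⁻¹ ^ 2)).sub (hG2.const_mul (s⁻¹ ^ 4))
  have hφ : Integrable (fun x => bump x * divg V (s • x)) := by
    refine ((hG.sub h1.1).sub hI').congr (Eventually.of_forall fun x => ?_)
    simp only [Pi.sub_apply]
    ring
  refine ⟨hφ, ?_⟩
  refine HasDerivAt.congr_deriv hD ?_
  rw [integral_congr_ae hae, integral_const_mul, mul_comm 2 s⁻¹, mul_assoc]
  congr 2
  symm
  have h3 := h1.2
  simp only [mul_assoc] at h3 hI' ⊢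
  rw [integral_sub _ hI', integral_sub _ hφ,
    integral_sub (hG1.const_mul _) (hG2.const_mul _), integral_const_mul, integral_const_mul] at h3
  · rw [weissJ]
    linarith
  · exact hG
  · exact hG.sub hφ

end PotentialField

end Monotonicity

section BlowUp

variable {n : ℕ}

lemma tendsto_integral_weight {k : En n → ℝ} (hk : Continuous k) (hk0 : ∀ x, 1 ≤ ‖x‖ → k x = 0)
    {P : En n × En n → ℝ} (hP : Continuous P) {v : ℕ → En n → En n} {w : En n → En n} {C : ℝ}
    (hv : ∀ j, Continuous (v j)) (hC : ∀ j x, ‖x‖ < 1 → ‖v j x‖ ≤ C)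
    (hlim : ∀ x, ‖x‖ < 1 → Tendsto (fun j => v j x) atTop (𝓝 (w x))) :
    Tendsto (fun j => ∫ x, k x * P (x, v j x)) atTop (𝓝 (∫ x, k x * P (x, w x))) := by
  obtain ⟨M, hM⟩ := ((isCompact_closedBall (0 : En n) 1).prod
    (isCompact_closedBall (0 : En n) C)).exists_bound_of_continuousOn hP.continuousOn
  refine tendsto_integral_of_dominated_convergence (fun x => |k x| * M)
    (fun j => (hk.mul (hP.comp (continuous_id.prodMk (hv j)))).aestronglyMeasurable)
    ((continuous_integrable hk hk0).abs.mul_const M)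
    (fun j => Eventually.of_forall fun x => ?_) (Eventually.of_forall fun x => ?_)
  · rcases lt_or_ge ‖x‖ 1 with hx | hx
    · rw [norm_mul, Real.norm_eq_abs]
      refine mul_le_mul_of_nonneg_left (hM _ ⟨?_, ?_⟩) (abs_nonneg _)
      · simpa using hx.le
      · simpa using hC j x hx
    · simp [hk0 x hx]
  · rcases lt_or_ge ‖x‖ 1 with hx | hx
    · exact ((hP.tendsto (x, w x)).comp
        (tendsto_const_nhds.prodMk_nhds (hlim x hx))).const_mul (k x)
    · simp [hk0 x hx]

lemma weissJ_eq (V : En n → En n) {s : ℝ} (hs : s ≠ 0) :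
    weissJ V s =
      (∫ x, bumpWeight x * (2 * inner ℝ x (s⁻¹ • V (s • x)) - n * ‖s⁻¹ • V (s • x)‖ ^ 2)) -
      ∫ x, bumpSecond x * (‖x‖ ^ 2 * ‖s⁻¹ • V (s • x)‖ ^ 2 -
        inner ℝ x (s⁻¹ • V (s • x)) ^ 2) := by
  rw [weissJ, ← integral_const_mul, ← integral_const_mul]
  congr 1
  · refine integral_congr_ae (Eventually.of_forall fun x => ?_)
    simp only [pairQ, norm_smul, real_inner_smul_left, real_inner_smul_right, mul_pow,
      Real.norm_eq_abs, sq_abs]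
    field_simp
  · refine integral_congr_ae (Eventually.of_forall fun x => ?_)
    simp only [crossQ, norm_smul, real_inner_smul_left, real_inner_smul_right, mul_pow,
      Real.norm_eq_abs, sq_abs]
    field_simp

lemma tendsto_weissJ {V : En n → En n} {C : NNReal} (hV : LipschitzWith C V) (hV0 : V 0 = 0)
    {r : ℕ → ℝ} (hr : ∀ k, 0 < r k) (A : En n →L[ℝ] En n)
    (hlim : ∀ x : En n, ‖x‖ < 1 → Tendsto (fun k => (r k)⁻¹ • V (r k • x)) atTop (𝓝 (A x)))
    {s : ℝ} (hs : 0 < s) :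
    Tendsto (fun k => weissJ V (r k)) atTop (𝓝 (weissJ A s)) := by
  have hA : ∀ x, s⁻¹ • A (s • x) = A x := fun x => by rw [map_smul, inv_smul_smul₀ hs.ne']
  have hcont : ∀ k, Continuous fun x => (r k)⁻¹ • V (r k • x) := fun k =>
    (continuous_const_smul _).comp (hV.continuous.comp (continuous_const_smul (r k)))
  have hbd : ∀ k (x : En n), ‖x‖ < 1 → ‖(r k)⁻¹ • V (r k • x)‖ ≤ C := by
    intro k x hx
    have h1 := hV.dist_le_mul (r k • x) 0
    rw [hV0, dist_zero_right, dist_zero_right, norm_smul, Real.norm_of_nonneg (hr k).le] at h1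
    rw [norm_smul, norm_inv, Real.norm_of_nonneg (hr k).le, inv_mul_le_iff₀ (hr k)]
    refine h1.trans ?_
    rw [mul_comm (r k) (C : ℝ)]
    have h2 : r k * ‖x‖ ≤ r k := mul_le_of_le_one_right (hr k).le hx.le
    exact mul_le_mul_of_nonneg_left h2 C.2
  simp only [fun k => weissJ_eq V (hr k).ne', weissJ_eq A hs.ne', hA]
  refine Tendsto.sub ?_ ?_
  · exact tendsto_integral_weight contDiff_bumpWeight.continuous (fun _ => bumpWeight_eq_zero)
      (P := fun p => 2 * inner ℝ p.1 p.2 - n * ‖p.2‖ ^ 2) (by fun_prop) hcont hbd hlim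
  · exact tendsto_integral_weight continuous_bumpSecond (fun _ => bumpSecond_eq_zero)
      (P := fun p => ‖p.1‖ ^ 2 * ‖p.2‖ ^ 2 - inner ℝ p.1 p.2 ^ 2) (by fun_prop) hcont hbd hlim

lemma PotentialField.weissJ_linear {P : En n → ℝ} {A : En n →L[ℝ] En n}
    (h : PotentialField P A) (hdiv : ∀ x, divg A x = 1) {s : ℝ} (hs : 0 < s) (hs1 : s < 1) :
    weissJ A s = ∫ x : En n, bump x := by
  have hH : heightH A =ᶠ[𝓝 s] fun _ => heightH A 1 := by
    filter_upwards [lt_mem_nhds hs] with σ hσ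
    simp only [heightH, ← integral_const_mul]
    refine integral_congr_ae (Eventually.of_forall fun x => ?_)
    simp only [map_smul, norm_smul, mul_pow, Real.norm_eq_abs, sq_abs]
    have := hσ.ne'
    field_simp
  have h1 := (h.hasDerivAt_heightH hs hs1).2.unique
    ((hasDerivAt_const s (heightH A 1)).congr_of_eventuallyEq hH)
  simp only [hdiv, mul_one] at h1
  have h2 : 2 * s⁻¹ ≠ 0 := by positivity
  linarith [(mul_eq_zero.1 h1).resolve_left h2]

/-- The gradient of the quadratic polynomial `qB B`. -/
def qBField (B : Matrix (Fin n) (Fin n) ℝ) : En n →L[ℝ] En n :=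
  (n : ℝ)⁻¹ • ContinuousLinearMap.id ℝ (En n) + Matrix.toEuclideanCLM (𝕜 := ℝ) B

lemma toEuclideanCLM_apply_apply (B : Matrix (Fin n) (Fin n) ℝ) (x : En n) (i : Fin n) :
    (Matrix.toEuclideanCLM (𝕜 := ℝ) B) x i = ∑ j, B i j * x j := by
  simp [Matrix.ofLp_toEuclideanCLM, Matrix.mulVec, dotProduct]

lemma psiM_eq_inner (B : Matrix (Fin n) (Fin n) ℝ) (x : En n) :
    psiM B x = 2⁻¹ * inner ℝ x (Matrix.toEuclideanCLM (𝕜 := ℝ) B x) := by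
  rw [psiM, inner_eq_sum, one_div]
  congr 1
  refine Finset.sum_congr rfl fun i _ => ?_
  rw [toEuclideanCLM_apply_apply, Finset.mul_sum]
  exact Finset.sum_congr rfl fun j _ => by ring

lemma inner_toEuclideanCLM_comm {B : Matrix (Fin n) (Fin n) ℝ} (hB : B.IsSymm) (x y : En n) :
    inner ℝ x (Matrix.toEuclideanCLM (𝕜 := ℝ) B y) =
      inner ℝ (Matrix.toEuclideanCLM (𝕜 := ℝ) B x) y := by
  simp only [inner_eq_sum, toEuclideanCLM_apply_apply, Finset.mul_sum, Finset.sum_mul]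
  rw [Finset.sum_comm]
  refine Finset.sum_congr rfl fun i _ => Finset.sum_congr rfl fun j _ => ?_
  rw [← hB.apply i j]
  ring

lemma hasFDerivAt_qB {B : Matrix (Fin n) (Fin n) ℝ} (hB : B.IsSymm) (x : En n) :
    HasFDerivAt (qB B) (innerSL ℝ (qBField B x)) x := by
  have h1 := (hasStrictFDerivAt_norm_sq x).hasFDerivAt.const_mul ((2 * n : ℝ)⁻¹)
  have h2 := ((hasFDerivAt_id x).inner ℝ
    (Matrix.toEuclideanCLM (𝕜 := ℝ) B).hasFDerivAt).const_mul (2⁻¹ : ℝ)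
  have e : qB B = fun y => (2 * n : ℝ)⁻¹ * ‖y‖ ^ 2 +
      2⁻¹ * inner ℝ (id y) (Matrix.toEuclideanCLM (𝕜 := ℝ) B y) := by
    funext y
    rw [qB, p0, psiM_eq_inner, div_eq_inv_mul, id]
  rw [e]
  refine (h1.add h2).congr_fderiv ?_
  ext p
  have h3 := inner_toEuclideanCLM_comm hB x p
  have h4 := real_inner_comm p (Matrix.toEuclideanCLM (𝕜 := ℝ) B x)
  simp [fderivInnerCLM_apply, qBField]
  linarith

lemma divg_qBField (hn : n ≠ 0) {B : Matrix (Fin n) (Fin n) ℝ} (hB : B.trace = 0) (x : En n) :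
    divg (qBField B) x = 1 := by
  have hn' : (n : ℝ) ≠ 0 := Nat.cast_ne_zero.2 hn
  have h : ∀ i, jac (qBField B) x i i = (n : ℝ)⁻¹ + B i i := by
    intro i
    rw [jac, ContinuousLinearMap.fderiv]
    simp [qBField, toEuclideanCLM_apply_apply]
  rw [divg, Finset.sum_congr rfl fun i _ => h i, Finset.sum_add_distrib]
  have hB' : ∑ i, B i i = 0 := hB
  simp [hB', hn']

lemma potentialField_qB (hn : n ≠ 0) {B : Matrix (Fin n) (Fin n) ℝ} (hB : S0 B) :
    PotentialField (qB B) (qBField B) where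
  lipschitz := ⟨_, (qBField B).lipschitz⟩
  hasFDerivAt x _ := hasFDerivAt_qB hB.1 x
  ae_divg := Eventually.of_forall fun x _ => Or.inl (divg_qBField hn hB.2 x)

lemma gradient_eq_of_hasFDerivAt {f : En n → ℝ} {x w : En n} (h : HasFDerivAt f (innerSL ℝ w) x) :
    gradient f x = w :=
  HasGradientAt.gradient (hasGradientAt_iff_hasFDerivAt.2 h)

lemma PotentialField.gradient_rescale {u : En n → ℝ} {V : En n → En n} (h : PotentialField u V)
    {r : ℝ} (hr : 0 < r) (hr1 : r < 1) {x : En n} (hx : ‖x‖ < 1) :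
    gradient (fun y => (u (r • y) - u 0) / r ^ 2) x = r⁻¹ • V (r • x) := by
  refine gradient_eq_of_hasFDerivAt ?_
  have h1 : HasFDerivAt (fun y : En n => r • y) (r • ContinuousLinearMap.id ℝ (En n)) x :=
    (hasFDerivAt_id x).const_smul r
  have h2 := ((((h.hasFDerivAt _ (smul_mem_ball hr hr1 hx)).comp x h1).sub_const (u 0)).mul_const
    ((r ^ 2)⁻¹))
  simp only [div_eq_mul_inv]
  refine h2.congr_fderiv ?_
  ext p
  simp
  field_simp

/-- At a singular point the energy dominates its value on quadratic blow-ups. -/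
lemma PotentialField.integral_bump_le_weissJ {u : En n → ℝ} {V : En n → En n}
    (h : PotentialField u V) (hV0 : V 0 = 0) (hn : n ≠ 0) (hsing : IsSingular u) {s : ℝ}
    (hs : 0 < s) (hs1 : s < 1) : ∫ x : En n, bump x ≤ weissJ V s := by
  obtain ⟨r, B, hr, hr0, hB, hconv⟩ := hsing
  obtain ⟨C, hC⟩ := h.lipschitz
  have hlim : ∀ x : En n, ‖x‖ < 1 →
      Tendsto (fun k => (r k)⁻¹ • V (r k • x)) atTop (𝓝 (qBField B x)) := by
    intro x hx
    have h1 := (hconv {x} isCompact_singleton).2.tendsto_at (Set.mem_singleton x)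
    rw [gradient_eq_of_hasFDerivAt (hasFDerivAt_qB hB.1 x)] at h1
    refine h1.congr' ?_
    filter_upwards [hr0.eventually_lt_const one_pos] with k hk
    exact h.gradient_rescale (hr k) hk hx
  have hJ := tendsto_weissJ hC hV0 hr (qBField B) hlim hs
  rw [(potentialField_qB hn hB).weissJ_linear (divg_qBField hn hB.2) hs hs1] at hJ
  refine le_of_tendsto hJ ?_
  filter_upwards [hr0.eventually_lt_const hs] with k hk
  exact h.monotoneOn_weissJ ⟨hr k, hk.trans hs1⟩ ⟨hs, hs1⟩ hk.le

end BlowUp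

section Conclusion

variable {n : ℕ}

lemma integrable_bump : Integrable (bump : En n → ℝ) :=
  continuous_integrable contDiff_bump.continuous fun _ => bump_eq_zero

namespace PotentialField

variable {u : En n → ℝ} {V : En n → En n}

lemma measurableSet_zero (h : PotentialField u V) (s : ℝ) :
    MeasurableSet {x : En n | V (s • x) = 0} :=
  (isClosed_eq (h.continuous.comp (continuous_const_smul s)) continuous_const).measurableSet

lemma setIntegral_bump_zero (h : PotentialField u V) {s : ℝ} (hs : 0 < s) (hs1 : s < 1) :
    ∫ x in {x | V (s • x) = 0}, bump x =
      (∫ x : En n, bump x) - ∫ x, bump x * divg V (s • x) := by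
  obtain ⟨C, hC⟩ := h.lipschitz
  rw [← integral_sub integrable_bump (h.hasDerivAt_heightH hs hs1).1,
    ← integral_indicator (h.measurableSet_zero s)]
  refine integral_congr_ae ?_
  filter_upwards [ae_comp_smul h.ae_divg hs.ne', ae_comp_smul hC.ae_fderiv_eq_zero hs.ne']
    with x hx hz
  rcases lt_or_ge ‖x‖ 1 with h1 | h1
  · by_cases hv : V (s • x) = 0
    · have hd : divg V (s • x) = 0 := by simp [divg, jac, hz hv]
      rw [Set.indicator_of_mem (by exact hv), hd]
      ring
    · rw [Set.indicator_of_notMem (by exact hv),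
        (hx (smul_mem_ball hs hs1 h1)).resolve_right fun h => hv h.1]
      ring
  · rw [bump_eq_zero h1, zero_mul, sub_zero, Set.indicator_apply_eq_zero]
    exact fun _ => bump_eq_zero h1

/-- The growth of the height controls the mass of the zero set. -/
lemma exists_hasDerivAt_heightH (h : PotentialField u V) {s : ℝ} (hs : 0 < s) (hs1 : s < 1)
    (hJ : ∫ x : En n, bump x ≤ weissJ V s) :
    ∃ H', 2 * s⁻¹ * (∫ x in {x | V (s • x) = 0}, bump x) ≤ H' ∧ HasDerivAt (heightH V) H' s := by
  refine ⟨_, ?_, (h.hasDerivAt_heightH hs hs1).2⟩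
  rw [h.setIntegral_bump_zero hs hs1]
  exact mul_le_mul_of_nonneg_left (by linarith) (by positivity)

lemma setIntegral_bump_nonneg (S : Set (En n)) : 0 ≤ ∫ x in S, bump x :=
  integral_nonneg fun x => bump_nonneg x

lemma setIntegral_zero_annulus_le (h : PotentialField u V) {s σ : ℝ} (hs : 0 < s)
    (h2 : 2 * s ≤ σ) (h4 : σ ≤ 4 * s) :
    expNegInvGlue (3 / 4) * (4 ^ n)⁻¹ * (∫ x in {x | V (s • x) = 0} ∩ ann0 n, ‖x‖ ^ 2) ≤
      ∫ x in {x | V (σ • x) = 0}, bump x := by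
  have hσ : 0 < σ := by linarith
  set a := s / σ with ha
  have ha0 : 0 < a := div_pos hs hσ
  have ha2 : a ≤ 1 / 2 := by
    rw [ha, div_le_iff₀ hσ]
    linarith
  have ha4 : 4⁻¹ ≤ a := by
    rw [ha, le_div_iff₀ hσ]
    linarith
  have haσ : ∀ x : En n, σ • a • x = s • x := fun x => by
    rw [smul_smul, ha, mul_div_cancel₀ _ hσ.ne']
  have hann : MeasurableSet (ann0 n) :=
    ((isOpen_lt continuous_const continuous_norm).inter
      (isOpen_lt continuous_norm continuous_const)).measurableSet
  have hN := h.measurableSet_zero s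
  have hcv := Measure.integral_comp_smul (volume : Measure (En n))
    (({x | V (σ • x) = 0}).indicator bump) a
  rw [integral_indicator (h.measurableSet_zero σ), smul_eq_mul, finrank_euclideanSpace_fin,
    abs_of_pos (inv_pos.2 (pow_pos ha0 n))] at hcv
  have hind : (fun x : En n => ({x | V (σ • x) = 0}).indicator bump (a • x)) =
      ({x | V (s • x) = 0}).indicator fun x => bump (a • x) := by
    funext x
    simp only [Set.indicator, Set.mem_ofPred_eq, haσ]
  have hIa : Integrable fun x : En n => bump (a • x) := integrable_bump.comp_smul ha0.ne'
  have hle : expNegInvGlue (3 / 4) * (∫ x in {x | V (s • x) = 0} ∩ ann0 n, ‖x‖ ^ 2) ≤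
      ∫ x, ({x | V (s • x) = 0}).indicator (fun x : En n => bump (a • x)) x := by
    rw [← integral_const_mul, ← integral_indicator (hN.inter hann)]
    refine integral_mono_of_nonneg (Eventually.of_forall fun x => ?_) (hIa.indicator hN)
      (Eventually.of_forall fun x => ?_)
    · exact Set.indicator_nonneg (fun y _ => mul_nonneg (expNegInvGlue.nonneg _) (sq_nonneg _)) x
    · by_cases hx : x ∈ {x | V (s • x) = 0} ∩ ann0 n
      · rw [Set.indicator_of_mem hx, Set.indicator_of_mem hx.1]
        have hx1 : ‖x‖ < 1 := hx.2.2
        have h5 : ‖a • x‖ ≤ 1 / 2 := by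
          rw [norm_smul, Real.norm_of_nonneg ha0.le]
          nlinarith [norm_nonneg x]
        have h6 : expNegInvGlue (3 / 4) ≤ bump (a • x) :=
          expNegInvGlue.monotone (by nlinarith [norm_nonneg (a • x)])
        refine le_trans (mul_le_of_le_one_right (expNegInvGlue.nonneg _) ?_) h6
        nlinarith [norm_nonneg x]
      · rw [Set.indicator_of_notMem hx]
        exact Set.indicator_nonneg (fun y _ => bump_nonneg _) x
  rw [← hind, hcv] at hle
  have hpow : ((4 : ℝ) ^ n)⁻¹ ≤ a ^ n := by
    rw [← inv_pow]
    exact pow_le_pow_left₀ (by norm_num) ha4 n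
  rw [inv_mul_eq_div, le_div_iff₀ (pow_pos ha0 n)] at hle
  refine le_trans ?_ hle
  have hF : 0 ≤ ∫ x in {x | V (s • x) = 0} ∩ ann0 n, ‖x‖ ^ 2 :=
    integral_nonneg fun x => sq_nonneg _
  have := mul_le_mul_of_nonneg_left hpow (mul_nonneg (expNegInvGlue.nonneg (3 / 4)) hF)
  linarith

lemma monotoneOn_heightH (h : PotentialField u V)
    (hJ : ∀ s : ℝ, 0 < s → s < 1 → ∫ x : En n, bump x ≤ weissJ V s) :
    MonotoneOn (heightH V) (Set.Ioo 0 1) := by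
  have hd : ∀ s ∈ Set.Ioo (0 : ℝ) 1, ∃ H', 0 ≤ H' ∧ HasDerivAt (heightH V) H' s := fun s hs => by
    obtain ⟨H', h1, h2⟩ := h.exists_hasDerivAt_heightH hs.1 hs.2 (hJ s hs.1 hs.2)
    exact ⟨H', (mul_nonneg (mul_nonneg two_pos.le (inv_pos.2 hs.1).le)
      (setIntegral_bump_nonneg _)).trans h1, h2⟩
  refine monotoneOn_of_deriv_nonneg (convex_Ioo 0 1) (fun s hs => ?_) (fun s hs => ?_)
    fun s hs => ?_
  · obtain ⟨H', -, hH⟩ := hd s hs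
    exact hH.continuousAt.continuousWithinAt
  · obtain ⟨H', -, hH⟩ := hd s (interior_subset hs)
    exact hH.differentiableAt.differentiableWithinAt
  · obtain ⟨H', h0, hH⟩ := hd s (interior_subset hs)
    rwa [hH.deriv]

lemma heightH_nonneg (V : En n → En n) (s : ℝ) : 0 ≤ heightH V s :=
  mul_nonneg (by positivity)
    (integral_nonneg fun x => mul_nonneg (bumpWeight_nonneg x) (sq_nonneg _))

lemma setIntegral_zero_annulus_le_heightH (h : PotentialField u V)
    (hJ : ∀ s : ℝ, 0 < s → s < 1 → ∫ x : En n, bump x ≤ weissJ V s) {s : ℝ} (hs : 0 < s)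
    (hs4 : 4 * s < 1) :
    expNegInvGlue (3 / 4) * (4 ^ n)⁻¹ * (∫ x in {x | V (s • x) = 0} ∩ ann0 n, ‖x‖ ^ 2) ≤
      heightH V (4 * s) - heightH V (2 * s) := by
  set c := expNegInvGlue (3 / 4) * (4 ^ n)⁻¹ *
    (∫ x in {x | V (s • x) = 0} ∩ ann0 n, ‖x‖ ^ 2) with hc
  have hc0 : 0 ≤ c := mul_nonneg (mul_nonneg (expNegInvGlue.nonneg _) (by positivity))
    (integral_nonneg fun x => sq_nonneg _)
  have hd : ∀ σ ∈ Set.Icc (2 * s) (4 * s),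
      ∃ H', (2 * s)⁻¹ * c ≤ H' ∧ HasDerivAt (heightH V) H' σ := by
    intro σ hσ
    have hσ0 : 0 < σ := by linarith [hσ.1]
    have hσ1 : σ < 1 := by linarith [hσ.2]
    obtain ⟨H', h1, h2⟩ := h.exists_hasDerivAt_heightH hσ0 hσ1 (hJ σ hσ0 hσ1)
    refine ⟨H', le_trans ?_ h1, h2⟩
    refine mul_le_mul ?_ (h.setIntegral_zero_annulus_le hs hσ.1 hσ.2) hc0 (by positivity)
    rw [← div_eq_mul_inv, inv_eq_one_div, div_le_div_iff₀ (by positivity) hσ0]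
    linarith [hσ.2]
  have key := (convex_Icc (2 * s) (4 * s)).mul_sub_le_image_sub_of_le_deriv
    (f := heightH V) (C := (2 * s)⁻¹ * c) (fun σ hσ => ?_) (fun σ hσ => ?_) (fun σ hσ => ?_)
    (2 * s) ⟨le_rfl, by linarith⟩ (4 * s) ⟨by linarith, le_rfl⟩ (by linarith)
  · refine le_trans (le_of_eq ?_) key
    field_simp
    ring
  · obtain ⟨H', -, hH⟩ := hd σ hσ
    exact hH.continuousAt.continuousWithinAt
  · obtain ⟨H', -, hH⟩ := hd σ (interior_subset hσ)
    exact hH.differentiableAt.differentiableWithinAt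
  · obtain ⟨H', h0, hH⟩ := hd σ (interior_subset hσ)
    rwa [hH.deriv]

end PotentialField

lemma LamT_inter_ann0 {u : En n → ℝ} {V : En n → En n}
    (hV : ∀ x ∈ ball (0 : En n) 1, gradient u x = V x) {t : ℝ} (ht : 0 < t) :
    LamT u t ∩ ann0 n = {x | V (Real.exp (-t) • x) = 0} ∩ ann0 n := by
  ext x
  refine and_congr_left fun hx => ?_
  have hb : Real.exp (-t) • x ∈ ball (0 : En n) 1 :=
    smul_mem_ball (Real.exp_pos _) (Real.exp_lt_one_iff.2 (by linarith)) hx.2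
  rw [LamT, Set.mem_smul_set_iff_inv_smul_mem₀ (Real.exp_pos t).ne', ← Real.exp_neg]
  change Real.exp (-t) • x ∈ ball (0 : En n) 1 ∧ gradient u (Real.exp (-t) • x) = 0 ↔ _
  rw [hV _ hb]
  exact and_iff_right hb

end Conclusion

/-- F₀(t) → 0 as t → ∞ at a singular point. -/
theorem stmt_11 (n : ℕ) (hn : 2 ≤ n) (u : En n → ℝ) (hu : SolutionHyp u)
    (hsing : IsSingular u) :
    Tendsto (fun t => F0 u t) atTop (nhds 0) := by
  obtain ⟨V, h, hV0, hV⟩ := hu.exists_potentialField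
  have hJ : ∀ s : ℝ, 0 < s → s < 1 → ∫ x : En n, bump x ≤ weissJ V s := fun s hs hs1 =>
    h.integral_bump_le_weissJ hV0 (by omega) hsing hs hs1
  set c : ℝ := expNegInvGlue (3 / 4) * (4 ^ n)⁻¹ with hc
  have hc0 : 0 < c := mul_pos (expNegInvGlue.pos_of_pos (by norm_num)) (by positivity)
  have hlim := (h.monotoneOn_heightH hJ).tendsto_nhdsWithin_Ioo_right
    (Set.nonempty_Ioo.2 one_pos) ⟨0, by
      rintro _ ⟨s, -, rfl⟩
      exact PotentialField.heightH_nonneg V s⟩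
  have hexp : ∀ m : ℝ, 0 < m → Tendsto (fun t : ℝ => m * Real.exp (-t)) atTop (𝓝[>] 0) := by
    intro m hm
    refine tendsto_nhdsWithin_iff.2 ⟨?_, Eventually.of_forall fun t =>
      mul_pos hm (Real.exp_pos _)⟩
    simpa using (Real.tendsto_exp_neg_atTop_nhds_zero).const_mul m
  have hdiff := ((hlim.comp (hexp 4 (by norm_num))).sub
    (hlim.comp (hexp 2 two_pos))).const_mul c⁻¹
  rw [sub_self, mul_zero] at hdiff
  refine squeeze_zero' (Eventually.of_forall fun t => integral_nonneg fun x => sq_nonneg _) ?_ hdiff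
  have hsmall : ∀ᶠ t : ℝ in atTop, 4 * Real.exp (-t) < 1 :=
    ((hexp 4 (by norm_num)).mono_right nhdsWithin_le_nhds).eventually_lt_const one_pos
  filter_upwards [hsmall, eventually_gt_atTop 0] with t ht ht0
  rw [F0, LamT_inter_ann0 hV ht0, inv_mul_eq_div, le_div_iff₀ hc0, mul_comm]
  exact h.setIntegral_zero_annulus_le_heightH hJ (Real.exp_pos _) ht

end
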